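/- arXiv:2604.01316 — 2 statements merged into one kernel-verified Lean document; each statement's English description precedes it below -/
import Mathlib

section
/- Let π ∈ ℤ[i] be a degree 1 prime with π ≡ 1 (mod λ³). Then the quadratic Gauss sum over ℤ[i] satisfies g₂(1, π) = (-1/π)₄ · N(π)^{1/2}. -/
noncomputable section

open scoped Classical
open Complex

abbrev Zi := GaussianInt

def lam : Zi := ⟨1, 1⟩

def Ni (x : Zi) : ℤ := Zsqrtd.norm x

/-- ě(z) = e^{2πi (z + z̄)} -/
def eCheck (z : ℂ) : ℂ := Complex.exp (2 * Real.pi * Complex.I * (z + (starRingEnd ℂ) z))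

/-- Quartic residue symbol at a prime modulus: the unique fourth root of unity
congruent to `α ^ ((N π - 1)/4)` modulo `π`. -/
def quarticPrime (α π : Zi) : Zi :=
  if h : ∃ u : Zi, u ^ 4 = 1 ∧ π ∣ α ^ ((Ni π - 1) / 4).toNat - u then h.choose else 0

/-- Quartic residue symbol `(α/γ)₄`, extended multiplicatively over the prime
factorization of `γ`, and declared `0` when `α, γ` are not coprime. -/
def quarticSym (α γ : Zi) : ℂ :=
  if IsCoprime α γ then
    ((UniqueFactorizationMonoid.factors γ).map
      fun π => GaussianInt.toComplex (quarticPrime α π)).prod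
  else 0

/-- Quadratic residue symbol `(α/γ)₂ = (α/γ)₄²`. -/
def quadSym (α γ : Zi) : ℂ := quarticSym α γ ^ 2

/-- Quartic Gauss sum `g₄(ν, c) = Σ_{d mod c} (d/c)₄ ě(ν d / c)`. -/
def g4 (ν : ℂ) (c : Zi) : ℂ :=
  ∑ᶠ x : Zi ⧸ Ideal.span {c},
    quarticSym (Quotient.out x) c *
      eCheck (ν * GaussianInt.toComplex (Quotient.out x) / GaussianInt.toComplex c)

/-- Quadratic Gauss sum `g₂(ν, c) = Σ_{d mod c} (d/c)₂ ě(ν d / c)`. -/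
def g2 (ν : ℂ) (c : Zi) : ℂ :=
  ∑ᶠ x : Zi ⧸ Ideal.span {c},
    quadSym (Quotient.out x) c *
      eCheck (ν * GaussianInt.toComplex (Quotient.out x) / GaussianInt.toComplex c)

/-- Euler totient on `ℤ[i]`. -/
def phiZ (c : Zi) : ℕ := Nat.card ((Zi ⧸ Ideal.span {c})ˣ)

section GaussSign

open Polynomial Finset

theorem prod_range_add_self {M : Type*} [CommMonoid M] (f : ℕ → M) (m : ℕ) :
    ∏ k ∈ range (m + m), f k = ∏ k ∈ range m, f k * f (m + m - 1 - k) := by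
  rw [prod_range_add, prod_mul_distrib, ← prod_range_reflect (fun k => f (m + k))]
  congr 1
  refine prod_congr rfl fun k hk => ?_
  have := mem_range.1 hk
  congr 1
  omega

theorem sum_eval_eq_neg_coeff {K : Type*} [Field K] [Fintype K] (Q : K[X])
    (hQ : Q.natDegree ≤ Fintype.card K - 1) :
    ∑ x : K, Q.eval x = -Q.coeff (Fintype.card K - 1) := by
  have h1 : 1 < Fintype.card K := Fintype.one_lt_card
  simp_rw [eval_eq_sum_range' (Nat.lt_succ_of_le hQ)]
  rw [sum_comm]
  simp_rw [← mul_sum]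
  rw [sum_range_succ, sum_eq_zero, zero_add]
  · have : ∑ x : K, x ^ (Fintype.card K - 1) = -1 := by
      have : ∀ x : K, x ^ (Fintype.card K - 1) = if x = 0 then 0 else 1 := by
        intro x
        split_ifs with h
        · rw [h, zero_pow (by omega)]
        · exact FiniteField.pow_card_sub_one_eq_one x h
      simp_rw [this]
      rw [sum_ite]
      simp [filter_ne', card_erase_of_mem, Nat.cast_sub h1.le]
    rw [this, mul_neg_one]
  · intro i hi
    rw [FiniteField.sum_pow_lt_card_sub_one K i (mem_range.1 hi), mul_zero]

theorem coeff_prod_range_of_coeff_zero {R : Type*} [CommRing R] (f : ℕ → R[X]) (m : ℕ)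
    (hf : ∀ k < m, (f k).coeff 0 = 0) :
    (∏ k ∈ range m, f k).coeff m = ∏ k ∈ range m, (f k).coeff 1 := by
  have h : ∏ k ∈ range m, f k = X ^ m * ∏ k ∈ range m, (f k).divX := by
    calc _ = ∏ k ∈ range m, (X * (f k).divX) := by
          refine prod_congr rfl fun k hk => ?_
          conv_lhs => rw [← X_mul_divX_add (f k), hf k (mem_range.1 hk), C_0, add_zero]
      _ = _ := by rw [prod_mul_distrib, prod_const, card_range]
  rw [h]
  have := coeff_X_pow_mul (∏ k ∈ range m, (f k).divX) m 0
  rw [zero_add] at this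
  rw [this, coeff_zero_prod]
  exact prod_congr rfl fun k _ => by rw [coeff_divX]

/-- The polynomial whose value at a `p`-th root of unity is the quadratic Gauss sum. -/
def gaussPoly (p : ℕ) [Fact p.Prime] : ℤ[X] :=
  ∑ x : ZMod p, C (quadraticChar (ZMod p) x) * X ^ x.val

/-- The polynomial whose value at `exp (2πi/p)` is, up to sign, a product of sines. -/
def sineProdPoly (p : ℕ) : ℤ[X] :=
  ∏ k ∈ range ((p - 1) / 2),
    (X ^ ((p + 1) / 2 * (k + 1)) - X ^ ((p + 1) / 2 * (p - (k + 1))))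

variable {p : ℕ} [Fact p.Prime]

theorem factorial_mul_coeff_taylor_gaussPoly (hp2 : p ≠ 2) :
    (((p - 1) / 2).factorial : ZMod p) *
      (taylor 1 ((gaussPoly p).map (Int.castRingHom (ZMod p)))).coeff ((p - 1) / 2) = -1 := by
  have hp : p.Prime := Fact.out
  have hodd := hp.eq_two_or_odd.resolve_left hp2
  have hp1 := hp.two_le
  set m := (p - 1) / 2 with hm
  have hring : ringChar (ZMod p) ≠ 2 := by rwa [ZMod.ringChar_zmod_n]
  have hcard : Fintype.card (ZMod p) / 2 = m := by rw [ZMod.card]; omega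
  have hQdeg : (X ^ m * descPochhammer (ZMod p) m).natDegree = m + m := by
    rw [(monic_X_pow m).natDegree_mul (monic_descPochhammer _ m), natDegree_X_pow,
      descPochhammer_natDegree]
  have hQm : (X ^ m * descPochhammer (ZMod p) m).Monic :=
    (monic_X_pow m).mul (monic_descPochhammer _ m)
  have hpm : Fintype.card (ZMod p) - 1 = m + m := by rw [ZMod.card]; omega
  have hs := sum_eval_eq_neg_coeff (X ^ m * descPochhammer (ZMod p) m) (by rw [hpm, hQdeg])
  rw [hpm] at hs
  have hlead : (X ^ m * descPochhammer (ZMod p) m).coeff (m + m) = 1 := by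
    rw [← hQdeg]; exact hQm
  rw [hlead] at hs
  rw [← hs, gaussPoly, Polynomial.map_sum, map_sum, finsetSum_coeff, mul_sum]
  refine sum_congr rfl fun x _ => ?_
  have hχ := quadraticChar_eq_pow_of_char_ne_two' hring x
  rw [hcard] at hχ
  rw [Polynomial.map_mul, map_C, Polynomial.map_pow, map_X, taylor_mul, taylor_C, taylor_X_pow,
    coeff_C_mul, C_1, coeff_X_add_one_pow, eq_intCast, hχ, eval_mul, eval_pow, eval_X]
  have : (descPochhammer (ZMod p) m).eval x = (x.val.descFactorial m : ZMod p) := by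
    rw [← descPochhammer_eval_eq_descFactorial, ZMod.natCast_zmod_val]
  rw [this, Nat.descFactorial_eq_factorial_mul_choose, Nat.cast_mul]
  ring

theorem coeff_taylor_sineProdPoly (hp2 : p ≠ 2) :
    (taylor 1 ((sineProdPoly p).map (Int.castRingHom (ZMod p)))).coeff ((p - 1) / 2) =
      (((p - 1) / 2).factorial : ZMod p) := by
  have hp : p.Prime := Fact.out
  have hodd := hp.eq_two_or_odd.resolve_left hp2
  have h2 : (2 : ZMod p) * (((p + 1) / 2 : ℕ) : ZMod p) = 1 := by
    have : 2 * ((p + 1) / 2) = p + 1 := by omega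
    have := congrArg (Nat.cast : ℕ → ZMod p) this
    simpa using this
  have hprod : ∀ f : ℕ → (ZMod p)[X], taylor 1 (∏ k ∈ range ((p - 1) / 2), f k) =
      ∏ k ∈ range ((p - 1) / 2), taylor 1 (f k) := fun f => map_prod (taylorAlgHom 1) _ _
  rw [sineProdPoly, Polynomial.map_prod, hprod, coeff_prod_range_of_coeff_zero, ← prod_range_add_one_eq_factorial, Nat.cast_prod]
  · refine prod_congr rfl fun k hk => ?_
    have hk := mem_range.1 hk
    rw [taylor_coeff_one]
    simp only [Polynomial.map_sub, Polynomial.map_pow, map_X, derivative_sub, derivative_X_pow,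
      eval_sub, eval_mul, eval_C, eval_pow, eval_X, one_pow, mul_one]
    push_cast [Nat.cast_sub (show k + 1 ≤ p by omega)]
    rw [CharP.cast_eq_zero (ZMod p) p]
    linear_combination ((k : ZMod p) + 1) * h2
  · intro k hk
    rw [taylor_coeff_zero]
    simp

theorem coeff_taylor_eq_zero_of_aeval_eq_zero {ζ : ℂ} (hζ : IsPrimitiveRoot ζ p) (f : ℤ[X])
    (hf : aeval ζ f = 0) {m : ℕ} (hm : m < p - 1) :
    (taylor 1 (f.map (Int.castRingHom (ZMod p)))).coeff m = 0 := by
  have hp : p.Prime := Fact.out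
  obtain ⟨g, rfl⟩ : cyclotomic p ℤ ∣ f := by
    rw [cyclotomic_eq_minpoly hζ hp.pos]
    exact minpoly.isIntegrallyClosed_dvd (hζ.isIntegral hp.pos) hf
  have : cyclotomic p (ZMod p) = (X - 1) ^ (p - 1) := by
    have h := cyclotomic_mul_prime_eq_pow_of_not_dvd (ZMod p) (p := p) (n := 1)
      (by simpa using hp.one_lt.ne')
    simpa using h
  rw [Polynomial.map_mul, map_cyclotomic, this, taylor_mul, taylor_pow, map_sub, taylor_X,
    taylor_one, add_sub_cancel_right, coeff_X_pow_mul', if_neg (by omega)]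

theorem factorial_half_sq (hp4 : p % 4 = 1) :
    (((p - 1) / 2).factorial : ZMod p) ^ 2 = -1 := by
  have hp : p.Prime := Fact.out
  have hp1 := hp.two_le
  rw [← ZMod.wilsons_lemma p]
  set m := (p - 1) / 2 with hm
  have hpm : p - 1 = m + m := by omega
  have hme : Even m := by rw [Nat.even_iff]; omega
  rw [hpm, ← prod_range_add_one_eq_factorial, ← prod_range_add_one_eq_factorial, Nat.cast_prod,
    Nat.cast_prod, prod_range_add_self, ← prod_pow]
  have : ∏ k ∈ range m, (-1 : ZMod p) = 1 := by rw [prod_const, card_range, hme.neg_one_pow]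
  rw [← mul_one (∏ k ∈ range m, _), ← this, ← prod_mul_distrib]
  refine prod_congr rfl fun k hk => ?_
  have hk := mem_range.1 hk
  have h : m + m - 1 - k + 1 = p - (k + 1) := by omega
  rw [h, Nat.cast_sub (by omega), CharP.cast_eq_zero (ZMod p) p]
  push_cast
  ring

theorem prod_two_mul_sin_sq (hp2 : p ≠ 2) :
    (∏ k ∈ range ((p - 1) / 2), 2 * Real.sin (Real.pi * (k + 1 : ℕ) / p)) ^ 2 = p := by
  have hp : p.Prime := Fact.out
  have hp1 := hp.two_le
  have hodd := hp.eq_two_or_odd.resolve_left hp2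
  set m := (p - 1) / 2 with hm
  have hpm : p - 1 = m + m := by omega
  have hp0 : (p : ℝ) ≠ 0 := by exact_mod_cast hp.ne_zero
  have hsin : ∀ k < m + m, 0 < Real.sin (Real.pi * (k + 1 : ℕ) / p) := by
    intro k hk
    have hpR : (0 : ℝ) < p := by exact_mod_cast hp.pos
    apply Real.sin_pos_of_pos_of_lt_pi
    · positivity
    · rw [div_lt_iff₀ hpR]
      have : ((k + 1 : ℕ) : ℝ) < p := by exact_mod_cast (by omega)
      exact mul_lt_mul_of_pos_left this Real.pi_pos
  have key : ∏ k ∈ range (m + m), 2 * Real.sin (Real.pi * (k + 1 : ℕ) / p) = p := by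
    have hz := Complex.isPrimitiveRoot_exp p hp.ne_zero
    have hpp : m + m + 1 = p := by omega
    have h := IsPrimitiveRoot.prod_one_sub_pow_eq_order (n := m + m)
      (μ := Complex.exp (2 * Real.pi * I / p)) (by rwa [hpp])
    have h' := congrArg norm h
    rw [norm_prod] at h'
    have : ‖((m + m : ℕ) : ℂ) + 1‖ = p := by
      rw [← Nat.cast_add_one, hpp]; simp
    rw [this] at h'
    refine Eq.trans ?_ h'
    refine prod_congr rfl fun k hk => ?_
    have hk := mem_range.1 hk
    rw [← Complex.exp_nat_mul, norm_sub_rev]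
    have : ((k + 1 : ℕ) : ℂ) * (2 * Real.pi * I / p) =
        I * ((2 * (Real.pi * (k + 1 : ℕ) / p) : ℝ) : ℂ) := by
      push_cast; ring
    rw [this, Complex.norm_exp_I_mul_ofReal_sub_one, mul_div_cancel_left₀ _ two_ne_zero,
      Real.norm_eq_abs, abs_of_pos]
    exact mul_pos two_pos (hsin k hk)
  rw [prod_range_add_self] at key
  refine Eq.trans ?_ key
  rw [← prod_pow]
  refine prod_congr rfl fun k hk => ?_
  have hk := mem_range.1 hk
  have h : m + m - 1 - k + 1 = p - (k + 1) := by omega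
  rw [h, Nat.cast_sub (by omega)]
  have : Real.pi * ((p : ℝ) - (k + 1 : ℕ)) / p = Real.pi - Real.pi * (k + 1 : ℕ) / p := by
    field_simp
  rw [this, Real.sin_pi_sub]
  ring

theorem prod_I_mul_neg_one_pow (t : ℕ) :
    ∏ k ∈ range (2 * t), (I * (-1) ^ (k + 1)) = 1 := by
  induction t with
  | zero => simp
  | succ t ih =>
    rw [show 2 * (t + 1) = 2 * t + 1 + 1 by ring, prod_range_succ, prod_range_succ, ih]
    have h : ((-1 : ℂ) ^ t) ^ 2 = 1 := by rw [← pow_mul, mul_comm, pow_mul]; simp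
    have h' : ((-1 : ℂ) ^ (2 * t)) = 1 := by rw [pow_mul]; simp
    simp only [pow_succ, h']
    linear_combination -I_mul_I

theorem aeval_sineProdPoly (hp4 : p % 4 = 1) :
    aeval (Complex.exp (2 * Real.pi * I / p)) (sineProdPoly p) = (Real.sqrt p : ℂ) := by
  have hp : p.Prime := Fact.out
  have hp1 := hp.two_le
  have hp2 : p ≠ 2 := by omega
  have hpR : (0 : ℝ) < p := by exact_mod_cast hp.pos
  have hpC : (p : ℂ) ≠ 0 := by exact_mod_cast hp.ne_zero
  have hsqrt : Real.sqrt p =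
      ∏ k ∈ range ((p - 1) / 2), 2 * Real.sin (Real.pi * (k + 1 : ℕ) / p) := by
    refine (congrArg Real.sqrt (prod_two_mul_sin_sq hp2).symm).trans (Real.sqrt_sq ?_)
    refine prod_nonneg fun k hk => ?_
    have hk := mem_range.1 hk
    refine mul_nonneg zero_le_two
      (Real.sin_nonneg_of_nonneg_of_le_pi (by positivity) ?_)
    rw [div_le_iff₀ hpR]
    have : ((k + 1 : ℕ) : ℝ) ≤ p := by exact_mod_cast (by omega)
    exact mul_le_mul_of_nonneg_left this Real.pi_pos.le
  obtain ⟨t, ht⟩ : ∃ t, (p - 1) / 2 = 2 * t := ⟨(p - 1) / 4, by omega⟩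
  have hI := prod_I_mul_neg_one_pow t
  rw [← ht] at hI
  rw [hsqrt, sineProdPoly, map_prod, ofReal_prod, ← one_mul (∏ k ∈ range ((p - 1) / 2), ofReal _),
    ← hI, ← prod_mul_distrib]
  refine prod_congr rfl fun k hk => ?_
  have hk := mem_range.1 hk
  have hh : (((p + 1) / 2 : ℕ) : ℂ) = ((p : ℂ) + 1) / 2 := by
    rw [Nat.cast_div (by omega) (by norm_num)]; push_cast; rfl
  simp only [map_sub, map_pow, aeval_X, ← Complex.exp_nat_mul]
  have e1 : (((p + 1) / 2 * (k + 1) : ℕ) : ℂ) * (2 * Real.pi * I / p) =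
      ((Real.pi * (k + 1 : ℕ) / p + (k + 1 : ℕ) * Real.pi : ℝ) : ℂ) * I := by
    push_cast [hh]; field_simp; ring
  have e2 : (((p + 1) / 2 * (p - (k + 1)) : ℕ) : ℂ) * (2 * Real.pi * I / p) =
      -((Real.pi * (k + 1 : ℕ) / p + (k + 1 : ℕ) * Real.pi : ℝ) : ℂ) * I +
        ((p + 1) / 2 : ℕ) * (2 * Real.pi * I) := by
    push_cast [hh, Nat.cast_sub (show k + 1 ≤ p by omega)]; field_simp; ring
  rw [e1, e2, Complex.exp_add, Complex.exp_nat_mul_two_pi_mul_I, mul_one]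
  have hs : ((-1) ^ (k + 1) * ((2 * Real.sin (Real.pi * (k + 1 : ℕ) / p) : ℝ) : ℂ)) =
      2 * Complex.sin ((Real.pi * (k + 1 : ℕ) / p + (k + 1 : ℕ) * Real.pi : ℝ) : ℂ) := by
    rw [← ofReal_sin, Real.sin_add_nat_mul_pi]; push_cast; ring
  rw [mul_assoc, hs, Complex.sin]
  set θ : ℂ := ((Real.pi * (k + 1 : ℕ) / p + (k + 1 : ℕ) * Real.pi : ℝ) : ℂ)
  linear_combination (Complex.exp (θ * I) - Complex.exp (-θ * I)) * I_mul_I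

/-- Gauss's evaluation of the quadratic Gauss sum, sign included, for `p ≡ 1 (mod 4)`. -/
theorem gaussSum_quadraticChar_stdAddChar (hp4 : p % 4 = 1) :
    gaussSum ((quadraticChar (ZMod p)).ringHomComp (Int.castRingHom ℂ)) ZMod.stdAddChar =
      (Real.sqrt p : ℂ) := by
  have hp : p.Prime := Fact.out
  have hp1 := hp.two_le
  have hp2 : p ≠ 2 := by omega
  have hring : ringChar (ZMod p) ≠ 2 := by rwa [ZMod.ringChar_zmod_n]
  have hζ := Complex.isPrimitiveRoot_exp p hp.ne_zero
  have hG : gaussSum ((quadraticChar (ZMod p)).ringHomComp (Int.castRingHom ℂ)) ZMod.stdAddChar =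
      aeval (Complex.exp (2 * Real.pi * I / p)) (gaussPoly p) := by
    rw [gaussSum, gaussPoly, map_sum]
    refine sum_congr rfl fun x _ => ?_
    rw [map_mul, aeval_C, map_pow, aeval_X, ← Complex.exp_nat_mul]
    congr 1
    have := ZMod.stdAddChar_coe (N := p) (x.val : ℤ)
    rw [Int.cast_natCast, ZMod.natCast_zmod_val] at this
    rw [this]
    congr 1
    push_cast
    ring
  have hsq : (aeval (Complex.exp (2 * Real.pi * I / p)) (gaussPoly p)) ^ 2 =
      (Real.sqrt p : ℂ) ^ 2 := by
    rw [← hG, gaussSum_sq _ ((quadraticChar_isQuadratic _).comp _) (ZMod.isPrimitive_stdAddChar p)]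
    · have h1 : quadraticChar (ZMod p) (-1) = 1 := by
        rw [quadraticChar_one_iff_isSquare (neg_ne_zero.2 one_ne_zero),
          FiniteField.isSquare_neg_one_iff, ZMod.card]
        omega
      rw [MulChar.ringHomComp_apply, h1, ← ofReal_pow, Real.sq_sqrt (Nat.cast_nonneg _), ZMod.card]
      simp
    · rw [Ne, MulChar.ringHomComp_eq_one_iff (RingHom.injective_int _)]
      exact quadraticChar_ne_one hring
  rw [hG]
  rw [← aeval_sineProdPoly hp4] at hsq ⊢
  rcases sq_eq_sq_iff_eq_or_eq_neg.1 hsq with h | h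
  · exact h
  exfalso
  have hz : aeval (Complex.exp (2 * Real.pi * I / p)) (gaussPoly p + sineProdPoly p) = 0 := by
    rw [map_add, h, neg_add_cancel]
  have hc := coeff_taylor_eq_zero_of_aeval_eq_zero hζ _ hz
    (show (p - 1) / 2 < p - 1 by omega)
  rw [Polynomial.map_add, map_add, coeff_add, coeff_taylor_sineProdPoly hp2] at hc
  have h1 := factorial_mul_coeff_taylor_gaussPoly hp2
  have h2 := factorial_half_sq hp4
  have h3 : (2 : ZMod p) = 0 := by
    linear_combination h1 + h2 - (((p - 1) / 2).factorial : ZMod p) * hc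
  rw [← Nat.cast_ofNat, ZMod.natCast_eq_zero_iff] at h3
  exact hp2 ((Nat.prime_dvd_prime_iff_eq hp Nat.prime_two).1 h3)

end GaussSign

section GaussianPrime

theorem im_even_of_lam_pow_three_dvd {π : Zi} (h : lam ^ 3 ∣ π - 1) : π.im % 2 = 0 := by
  obtain ⟨c, hc⟩ := h
  have h3 : lam ^ 3 = ⟨-2, 2⟩ := by
    ext <;> simp [lam, pow_succ]
  rw [h3] at hc
  have := congrArg Zsqrtd.im hc
  simp at this
  omega

theorem Ni_eq (π : Zi) : Ni π = π.re ^ 2 + π.im ^ 2 := by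
  simp only [Ni, Zsqrtd.norm]
  ring

theorem quadraticChar_two_eq {p : ℕ} [Fact p.Prime] (hp4 : p % 4 = 1) :
    quadraticChar (ZMod p) 2 = (-1) ^ ((p - 1) / 4) := by
  rw [quadraticChar_two (by rw [ZMod.ringChar_zmod_n]; omega), ZMod.card,
    ZMod.χ₈_nat_eq_if_mod_eight]
  obtain h | h : p % 8 = 1 ∨ p % 8 = 5 := by omega
  · rw [if_neg (by omega), if_pos (Or.inl h), Even.neg_one_pow]
    rw [Nat.even_iff]; omega
  · rw [if_neg (by omega), if_neg (by omega), Odd.neg_one_pow]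
    rw [Nat.odd_iff]; omega

theorem quadraticChar_intCast_eq_one_of_sq_add_sq {p : ℕ} [Fact p.Prime] (hp4 : p % 4 = 1) {a b : ℤ}
    (ha : a % 2 = 1) (hab : a ^ 2 + b ^ 2 = p) : quadraticChar (ZMod p) (a : ZMod p) = 1 := by
  have hp : p.Prime := Fact.out
  have hodd : Odd p := Nat.odd_iff.2 (by omega)
  have haodd : Odd a.natAbs := by rw [Int.natAbs_odd]; exact Int.odd_iff.2 ha
  have habs : jacobiSym a p = jacobiSym (a.natAbs : ℤ) p := by
    rcases Int.natAbs_eq a with h | h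
    · rw [← h]
    · conv_lhs => rw [h]
      rw [jacobiSym.neg _ hodd, ZMod.χ₄_nat_one_mod_four hp4, one_mul]
  have hcop : Int.gcd b a.natAbs = 1 := by
    rw [Int.gcd_eq_natAbs, Int.natAbs_natCast]
    refine Nat.Coprime.symm (Nat.Coprime.gcd_eq_one (Nat.coprime_of_dvd' fun q hq h1 h2 => ?_))
    have h1' : (q : ℤ) ∣ a := Int.natCast_dvd.2 h1
    have h2' : (q : ℤ) ∣ b := Int.natCast_dvd.2 h2
    have h3 : ((q ^ 2 : ℕ) : ℤ) ∣ (p : ℤ) := by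
      rw [← hab]
      push_cast
      exact dvd_add (pow_dvd_pow_of_dvd h1' 2) (pow_dvd_pow_of_dvd h2' 2)
    have h4 := Int.natCast_dvd_natCast.1 h3
    have h5 := (Nat.prime_dvd_prime_iff_eq hq hp).1 ((dvd_pow_self q two_ne_zero).trans h4)
    subst h5
    have := Nat.le_of_dvd hp.pos h4
    nlinarith [hp.two_le]
  change legendreSym p a = 1
  rw [jacobiSym.legendreSym.to_jacobiSym, habs,
    jacobiSym.quadratic_reciprocity_one_mod_four' haodd hp4,
    ← jacobiSym.sq_one' hcop]
  refine jacobiSym.mod_left' ?_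
  rw [← hab]
  refine Int.emod_eq_emod_iff_emod_sub_eq_zero.2 (Int.emod_eq_zero_of_dvd ?_)
  rw [add_sub_cancel_right]
  exact dvd_pow (Int.natAbs_dvd.2 dvd_rfl) two_ne_zero

/-- The reduction `ℤ[i] → ℤ/p` modulo a degree one prime `π = a + bi`; there `a x ≡ a Re x + b Im x`. -/
theorem exists_residue_hom {π : Zi} (hπ : Prime π) {p : ℕ} [Fact p.Prime]
    (hN : π.re ^ 2 + π.im ^ 2 = p) :
    ∃ ψ : Zi →+* ZMod p, (∀ x, π ∣ x ↔ ψ x = 0) ∧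
      ∀ x, (π.re : ZMod p) * ψ x = (π.re * x.re + π.im * x.im : ℤ) := by
  have hp : p.Prime := Fact.out
  have hN' : (π.re : ZMod p) ^ 2 + (π.im : ZMod p) ^ 2 = 0 := by
    have := congrArg (Int.cast : ℤ → ZMod p) hN
    simpa using this
  have ha : (π.re : ZMod p) ≠ 0 := by
    intro h
    have h' : (π.im : ZMod p) = 0 := by simpa [h] using hN'
    rw [ZMod.intCast_zmod_eq_zero_iff_dvd] at h h'
    have h3 : ((p ^ 2 : ℕ) : ℤ) ∣ (p : ℤ) := by
      rw [← hN]
      push_cast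
      exact dvd_add (pow_dvd_pow_of_dvd h 2) (pow_dvd_pow_of_dvd h' 2)
    have h4 := Nat.le_of_dvd hp.pos (Int.natCast_dvd_natCast.1 h3)
    nlinarith [hp.two_le]
  have hr : (π.im / π.re : ZMod p) * (π.im / π.re : ZMod p) = ((-1 : ℤ) : ZMod p) := by
    field_simp
    push_cast
    linear_combination hN'
  let ψ : Zi →+* ZMod p := Zsqrtd.lift ⟨_, hr⟩
  have hψ : ∀ x, ψ x = x.re + x.im * (π.im / π.re : ZMod p) := fun x => rfl
  have hψπ : ψ π = 0 := by
    rw [hψ]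
    field_simp
    linear_combination hN'
  refine ⟨ψ, fun x => ⟨?_, fun hx => ?_⟩, fun x => ?_⟩
  · rintro ⟨y, rfl⟩
    rw [map_mul, hψπ, zero_mul]
  · by_contra hd
    obtain ⟨u, v, huv⟩ := hπ.coprime_iff_not_dvd.2 hd
    have := congrArg ψ huv
    rw [map_add, map_mul, map_mul, hψπ, hx, mul_zero, mul_zero, add_zero, map_one] at this
    exact zero_ne_one this
  · rw [hψ]
    push_cast
    field_simp

section Symbol

variable {π : Zi} {p : ℕ} [Fact p.Prime] {ψ : Zi →+* ZMod p}

theorem quarticPrime_spec (hp4 : p % 4 = 1) (hψ : ∀ x, π ∣ x ↔ ψ x = 0) (hdeg : Ni π = p)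
    {q : Zi} (hq : Associated π q) {α : Zi} (hα : ψ α ≠ 0) :
    quarticPrime α q ^ 4 = 1 ∧ ψ (quarticPrime α q) = ψ α ^ ((p - 1) / 4) := by
  have hp : p.Prime := Fact.out
  have hNq : Ni q = p := by
    rw [← hdeg]
    obtain ⟨u, rfl⟩ := hq
    have hu : Ni (u : Zi) = 1 := (Zsqrtd.norm_eq_one_iff' (by norm_num) _).2 u.isUnit
    simp only [Ni] at hu ⊢
    rw [Zsqrtd.norm_mul, hu, mul_one]
  have hexp : ((Ni q - 1) / 4).toNat = (p - 1) / 4 := by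
    have := hp.two_le
    rw [hNq]; omega
  have hdvd : ∀ x, q ∣ x ↔ ψ x = 0 := fun x => by rw [← hq.dvd_iff_dvd_left, hψ]
  have hex : ∃ u : Zi, u ^ 4 = 1 ∧ q ∣ α ^ ((Ni q - 1) / 4).toNat - u := by
    rw [hexp]
    simp_rw [hdvd, map_sub, map_pow, sub_eq_zero]
    have hv : (ψ α ^ ((p - 1) / 4)) ^ 4 = 1 := by
      rw [← pow_mul, show (p - 1) / 4 * 4 = p - 1 by omega]
      exact ZMod.pow_card_sub_one_eq_one hα
    set v := ψ α ^ ((p - 1) / 4)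
    have hi : (⟨0, 1⟩ : Zi) ^ 2 = -1 := by ext <;> simp [pow_two]
    have hi' : ψ ⟨0, 1⟩ ^ 2 = -1 := by rw [← map_pow, hi, map_neg, map_one]
    have hfac : (v - 1) * (v + 1) * ((v - ψ ⟨0, 1⟩) * (v + ψ ⟨0, 1⟩)) = 0 := by
      linear_combination hv - (v ^ 2 - 1) * hi'
    have hi4 : (⟨0, 1⟩ : Zi) ^ 4 = 1 := by rw [show 4 = 2 * 2 by rfl, pow_mul, hi]; ring
    rcases mul_eq_zero.1 hfac with h | h <;> rcases mul_eq_zero.1 h with h | h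
    · exact ⟨1, by ring, by rw [map_one]; linear_combination h⟩
    · exact ⟨-1, by ring, by rw [map_neg, map_one]; linear_combination h⟩
    · exact ⟨⟨0, 1⟩, hi4, by linear_combination h⟩
    · exact ⟨-⟨0, 1⟩, by rw [Even.neg_pow (by decide), hi4], by rw [map_neg]; linear_combination h⟩
  have hspec := hex.choose_spec
  have hqp : quarticPrime α q = hex.choose := by rw [quarticPrime, dif_pos hex]
  rw [← hqp, hexp, hdvd, map_sub, map_pow, sub_eq_zero] at hspec
  exact ⟨hspec.1, hspec.2.symm⟩

theorem quarticSym_of_dvd (hπ : Prime π) (hψ : ∀ x, π ∣ x ↔ ψ x = 0) {α : Zi} (hα : ψ α = 0) :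
    quarticSym α π = 0 := by
  rw [quarticSym, if_neg]
  rw [isCoprime_comm, hπ.coprime_iff_not_dvd, hψ, not_not]
  exact hα

theorem exists_quarticSym_eq (hπ : Prime π) (hp4 : p % 4 = 1) (hψ : ∀ x, π ∣ x ↔ ψ x = 0)
    (hdeg : Ni π = p) {α : Zi} (hα : ψ α ≠ 0) :
    ∃ u : Zi, quarticSym α π = GaussianInt.toComplex u ∧ u ^ 4 = 1 ∧
      ψ u = ψ α ^ ((p - 1) / 4) := by
  obtain ⟨q, hq, hfac⟩ := prime_factors_irreducible hπ.irreducible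
    ⟨UniqueFactorizationMonoid.prime_of_factor,
      UniqueFactorizationMonoid.factors_prod hπ.ne_zero⟩
  refine ⟨quarticPrime α q, ?_, quarticPrime_spec hp4 hψ hdeg hq hα⟩
  rw [quarticSym, if_pos, hfac, Multiset.map_singleton, Multiset.prod_singleton]
  rw [isCoprime_comm, hπ.coprime_iff_not_dvd, hψ]
  exact hα

theorem eq_one_of_sq_eq_one_of_map_eq_one (hp2 : p ≠ 2) {w : Zi} (hw : w ^ 2 = 1)
    (hψw : ψ w = 1) : w = 1 := by
  have hp : p.Prime := Fact.out
  have : Fact (2 < p) := ⟨lt_of_le_of_ne hp.two_le hp2.symm⟩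
  refine (sq_eq_sq_iff_eq_or_eq_neg.1 (hw.trans (one_pow 2).symm)).resolve_right fun h => ?_
  rw [h, map_neg, map_one] at hψw
  exact ZMod.neg_one_ne_one hψw

theorem eq_one_of_pow_four_eq_one_of_map_eq_one (hp2 : p ≠ 2) {w : Zi} (hw : w ^ 4 = 1)
    (hψw : ψ w = 1) : w = 1 := by
  refine eq_one_of_sq_eq_one_of_map_eq_one hp2
    (eq_one_of_sq_eq_one_of_map_eq_one (ψ := ψ) hp2 ?_ ?_) hψw
  · rw [← pow_mul, hw]
  · rw [map_pow, hψw, one_pow]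

theorem quarticSym_neg_one (hπ : Prime π) (hp4 : p % 4 = 1) (hψ : ∀ x, π ∣ x ↔ ψ x = 0)
    (hdeg : Ni π = p) : quarticSym (-1) π = (-1) ^ ((p - 1) / 4) := by
  have hψ1 : ψ (-1) = -1 := by rw [map_neg, map_one]
  obtain ⟨u, hu, hu4, hψu⟩ := exists_quarticSym_eq hπ hp4 hψ hdeg (α := -1)
    (by rw [hψ1]; exact neg_ne_zero.2 one_ne_zero)
  have hs : ((-1 : Zi) ^ ((p - 1) / 4)) * (-1) ^ ((p - 1) / 4) = 1 := by
    rw [← mul_pow]; simp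
  have h := eq_one_of_pow_four_eq_one_of_map_eq_one (p := p) (ψ := ψ) (by omega)
    (w := u * (-1) ^ ((p - 1) / 4))
    (by rw [mul_pow, hu4, ← pow_mul, mul_comm _ 4, pow_mul,
      show (-1 : Zi) ^ 4 = 1 by ring, one_pow, one_mul])
    (by rw [map_mul, hψu, map_pow, hψ1, ← mul_pow]; simp)
  have hu' : u = (-1) ^ ((p - 1) / 4) := by
    linear_combination (-1) ^ ((p - 1) / 4) * h - u * hs
  rw [hu, hu', map_pow, map_neg, map_one]

theorem quadSym_eq_quadraticChar (hπ : Prime π) (hp4 : p % 4 = 1) (hψ : ∀ x, π ∣ x ↔ ψ x = 0)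
    (hdeg : Ni π = p) (α : Zi) : quadSym α π = (quadraticChar (ZMod p) (ψ α) : ℂ) := by
  have hp2 : p ≠ 2 := by omega
  by_cases hα : ψ α = 0
  · rw [quadSym, quarticSym_of_dvd hπ hψ hα, hα, quadraticChar_zero]
    simp
  obtain ⟨u, hu, hu4, hψu⟩ := exists_quarticSym_eq hπ hp4 hψ hdeg hα
  have hχ := quadraticChar_eq_pow_of_char_ne_two' (by rwa [ZMod.ringChar_zmod_n]) (ψ α)
  have hχ2 := quadraticChar_sq_one hα
  set c := quadraticChar (ZMod p) (ψ α)
  have hcc : ((c : Zi)) * c = 1 := by rw [← pow_two]; exact_mod_cast hχ2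
  have hψu2 : ψ (u ^ 2) = c := by
    rw [hχ, map_pow, hψu, ← pow_mul, ZMod.card]
    congr 1
    omega
  have h := eq_one_of_sq_eq_one_of_map_eq_one (p := p) (ψ := ψ) hp2 (w := u ^ 2 * c)
    (by rw [mul_pow, ← pow_mul, hu4, pow_two, hcc, one_mul])
    (by rw [map_mul, hψu2, ← map_intCast ψ, ← map_mul, hcc, map_one])
  have hu' : u ^ 2 = c := by linear_combination (c : Zi) * h - u ^ 2 * hcc
  rw [quadSym, hu, ← map_pow, hu', map_intCast]

theorem eCheck_div_eq_stdAddChar (hN : π.re ^ 2 + π.im ^ 2 = p)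
    (hψ : ∀ x, (π.re : ZMod p) * ψ x = (π.re * x.re + π.im * x.im : ℤ)) (x : Zi) :
    eCheck (GaussianInt.toComplex x / GaussianInt.toComplex π) =
      ZMod.stdAddChar (2 * π.re * ψ x : ZMod p) := by
  have hp : p.Prime := Fact.out
  have hpC : (p : ℂ) ≠ 0 := by exact_mod_cast hp.ne_zero
  have hNC : (π.re : ℂ) ^ 2 + (π.im : ℂ) ^ 2 = p := by exact_mod_cast hN
  have h1 : (2 * π.re * ψ x : ZMod p) = ((2 * (π.re * x.re + π.im * x.im) : ℤ) : ZMod p) := by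
    rw [mul_assoc, hψ]
    push_cast
    ring
  have hπ1 : ((π.re : ℂ) + π.im * I) ≠ 0 := fun h => hpC (by
    rw [← hNC]
    linear_combination ((π.re : ℂ) - π.im * I) * h + (π.im : ℂ) ^ 2 * I_mul_I)
  have hπ2 : ((π.re : ℂ) + π.im * -I) ≠ 0 := fun h => hpC (by
    rw [← hNC]
    linear_combination ((π.re : ℂ) + π.im * I) * h + (π.im : ℂ) ^ 2 * I_mul_I)
  rw [h1, ZMod.stdAddChar_coe, eCheck, GaussianInt.toComplex_def, GaussianInt.toComplex_def]
  congr 1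
  rw [mul_div_assoc]
  congr 1
  simp only [map_div₀, map_add, map_mul, conj_I, map_intCast]
  push_cast
  have hmul : ((π.re : ℂ) + π.im * I) * (π.re + π.im * -I) = p := by
    rw [← hNC]
    linear_combination -(π.im : ℂ) ^ 2 * I_mul_I
  rw [div_add_div _ _ hπ1 hπ2, hmul]
  congr 1
  linear_combination -2 * (π.im : ℂ) * x.im * I_mul_I

end Symbol

theorem finsum_quotient_eq_sum {M : Type*} [AddCommMonoid M] {π : Zi} {p : ℕ} [Fact p.Prime]
    {ψ : Zi →+* ZMod p} (hψ : ∀ x, π ∣ x ↔ ψ x = 0) (F : ZMod p → M) :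
    ∑ᶠ x : Zi ⧸ Ideal.span {π}, F (ψ (Quotient.out x)) = ∑ t : ZMod p, F t := by
  rw [← finsum_eq_sum_of_fintype]
  have hψ' : ∀ x y, Ideal.Quotient.mk (Ideal.span {π}) x = Ideal.Quotient.mk _ y ↔ ψ x = ψ y := by
    intro x y
    rw [Ideal.Quotient.mk_eq_mk_iff_sub_mem, Ideal.mem_span_singleton, hψ, map_sub, sub_eq_zero]
  refine finsum_eq_of_bijective (fun x : Zi ⧸ Ideal.span {π} => ψ (Quotient.out x))
    ⟨fun x y hxy => ?_, fun t => ?_⟩ fun x => rfl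
  · rw [← Ideal.Quotient.mk_out x, ← Ideal.Quotient.mk_out y, hψ']
    exact hxy
  · obtain ⟨z, rfl⟩ := ZMod.ringHom_surjective ψ t
    exact ⟨Ideal.Quotient.mk _ z, (hψ' _ _).1 (Ideal.Quotient.mk_out _)⟩

end GaussianPrime

/-- evaluation of the quadratic Gauss sum at a degree 1 prime. -/
theorem quad_gauss_sum_eval (π : Zi) (hπ : Prime π) (hcong : lam ^ 3 ∣ π - 1)
    (p : ℕ) (hp : Nat.Prime p) (hmod : p % 4 = 1) (hdeg : Ni π = (p : ℤ)) :
    g2 1 π = quarticSym (-1) π * (Real.sqrt ((Ni π : ℝ)) : ℂ) := by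
  have : Fact p.Prime := ⟨hp⟩
  have hN : π.re ^ 2 + π.im ^ 2 = p := by rw [← Ni_eq, hdeg]
  have hre : π.re % 2 = 1 := by
    rcases Int.emod_two_eq_zero_or_one π.re with h | h
    · exfalso
      have h1 : (2 : ℤ) ∣ π.re ^ 2 + π.im ^ 2 :=
        dvd_add (dvd_pow (Int.dvd_of_emod_eq_zero h) two_ne_zero)
          (dvd_pow (Int.dvd_of_emod_eq_zero (im_even_of_lam_pow_three_dvd hcong)) two_ne_zero)
      rw [hN] at h1
      omega
    · exact h
  obtain ⟨ψ, hker, hψ⟩ := exists_residue_hom hπ hN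
  set χ := (quadraticChar (ZMod p)).ringHomComp (Int.castRingHom ℂ) with hχ
  have hχa : quadraticChar (ZMod p) (2 * π.re : ZMod p) = (-1) ^ ((p - 1) / 4) := by
    rw [map_mul, quadraticChar_two_eq hmod,
      quadraticChar_intCast_eq_one_of_sq_add_sq hmod hre hN, mul_one]
  have hunit : IsUnit (2 * π.re : ZMod p) := by
    rw [isUnit_iff_ne_zero, Ne, ← quadraticChar_eq_zero_iff, hχa]
    exact pow_ne_zero _ (by norm_num)
  have hsum : g2 1 π = gaussSum χ (ZMod.stdAddChar.mulShift (2 * π.re : ZMod p)) := by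
    rw [gaussSum, ← finsum_quotient_eq_sum hker, g2]
    refine finsum_congr fun x => ?_
    rw [one_mul, quadSym_eq_quadraticChar hπ hmod hker hdeg,
      eCheck_div_eq_stdAddChar hN hψ, AddChar.mulShift_apply]
    rfl
  have hinv : χ⁻¹ = χ := ((quadraticChar_isQuadratic (ZMod p)).comp _).inv
  rw [hsum, ← hunit.unit_spec, gaussSum_mulShift_eq, hinv, hunit.unit_spec,
    gaussSum_quadraticChar_stdAddChar hmod, quarticSym_neg_one hπ hmod hker hdeg, hχ,
    MulChar.ringHomComp_apply, hχa, hdeg]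
  simp
end
end

section
/- Let γ, π ∈ ℤ[i] with γ ≡ π ≡ 1 (mod λ³), π prime, π ∤ γ, and let δ ∈ λ^{-2}ℤ[i] with gcd(δ, π) = 1, v ≡ 1 (mod λ³), and s ∈ ℂ with Re(s) > 3/2. Define ψ_α(r, s; v) := Σ_{c ≡ v (mod 4), gcd(c, α)=1} g₄(r, c)/N(c)^s. Then ψ_γ(δπ³, s; v) = (1 - N(π)^{3-4s}) · ψ_{γπ}(δπ³, s; v). -/
noncomputable section

open scoped Classical
open Complex

/-- The twisted Dirichlet series of quartic Gauss sums
`ψ_α(r, s; v) = Σ_{c ≡ v (4), (c,α)=1} g₄(r,c) / N(c)^s`. -/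
def psiA (α : Zi) (r s : ℂ) (v : Zi) : ℂ :=
  ∑' c : Zi, if (4 : Zi) ∣ c - v ∧ IsCoprime c α then g4 r c / (Ni c : ℂ) ^ s else 0

/-! ### Residue rings of the Gaussian integers -/

/-- The coordinate isomorphism `ℤ[i] ≃ ℤ²`. -/
def gaussianCoords : Zi ≃ₗ[ℤ] (Fin 2 → ℤ) where
  toFun z := ![z.re, z.im]
  invFun f := ⟨f 0, f 1⟩
  map_add' x y := by
    ext i
    fin_cases i <;> simp
  map_smul' n x := by
    ext i
    fin_cases i <;> simp
  left_inv x := rfl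
  right_inv f := by
    ext i
    fin_cases i <;> rfl

/-- The `ℤ`-basis `1, i` of the Gaussian integers. -/
def gaussianBasis : Module.Basis (Fin 2) ℤ Zi := Module.Basis.ofEquivFun gaussianCoords

instance gaussianInt_free : Module.Free ℤ Zi := Module.Free.of_basis gaussianBasis

instance gaussianInt_finite : Module.Finite ℤ Zi := Module.Finite.of_basis gaussianBasis

lemma gaussian_algebraNorm (c : Zi) : Algebra.norm ℤ c = Ni c := by
  have h0 : gaussianBasis 0 = ⟨1, 0⟩ := by
    rw [gaussianBasis, Module.Basis.coe_ofEquivFun]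
    rfl
  have h1 : gaussianBasis 1 = ⟨0, 1⟩ := by
    rw [gaussianBasis, Module.Basis.coe_ofEquivFun]
    rfl
  have hr : ∀ z : Zi, gaussianBasis.repr z 0 = z.re := fun _ => rfl
  have hi : ∀ z : Zi, gaussianBasis.repr z 1 = z.im := fun _ => rfl
  rw [Algebra.norm_eq_matrix_det gaussianBasis, Matrix.det_fin_two]
  simp only [Algebra.leftMulMatrix_eq_repr_mul, h0, h1, hr, hi]
  simp [Ni, Zsqrtd.norm]

lemma card_residues (c : Zi) : (Nat.card (Zi ⧸ Ideal.span {c}) : ℤ) = Ni c := by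
  have h : Nat.card (Zi ⧸ Ideal.span {c}) = Ideal.absNorm (Ideal.span {c}) := by
    rw [Ideal.absNorm_apply, Submodule.cardQuot_apply]
  rw [h, Ideal.absNorm_span_singleton, gaussian_algebraNorm]
  exact GaussianInt.abs_natCast_norm c

lemma finite_residues {c : Zi} (hc : c ≠ 0) : Finite (Zi ⧸ Ideal.span {c}) :=
  Ideal.finiteQuotientOfFreeOfNeBot _ (by simpa using hc)

lemma Ni_mul (a b : Zi) : Ni (a * b) = Ni a * Ni b := Zsqrtd.norm_mul a b

lemma Ni_pos {c : Zi} (hc : c ≠ 0) : 0 < Ni c := GaussianInt.norm_pos.2 hc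

lemma Ni_dvd {a b : Zi} (h : a ∣ b) : Ni a ∣ Ni b := by
  obtain ⟨k, rfl⟩ := h
  exact ⟨Ni k, Ni_mul a k⟩

lemma odd_Ni_of_dvd {a b : Zi} (h : a ∣ b) (hb : Odd (Ni b)) : Odd (Ni a) := by
  obtain ⟨k, rfl⟩ := h
  rw [Ni_mul, Int.odd_mul] at hb
  exact hb.1

lemma ne_zero_of_odd_Ni {c : Zi} (hc : Odd (Ni c)) : c ≠ 0 := by
  rintro rfl
  simp [Ni] at hc

/-- The sum over the residues modulo `c` of a function on `ℤ[i]`. -/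
def residueSum (c : Zi) (f : Zi → ℂ) : ℂ :=
  ∑ᶠ x : Zi ⧸ Ideal.span {c}, f (Quotient.out x)

lemma dvd_out_sub (c d : Zi) :
    c ∣ Quotient.out (Ideal.Quotient.mk (Ideal.span {c}) d) - d := by
  rw [← Ideal.mem_span_singleton, ← Ideal.Quotient.eq]
  exact Quotient.out_eq (Ideal.Quotient.mk (Ideal.span {c}) d)

lemma mk_out (c : Zi) (x : Zi ⧸ Ideal.span {c}) :
    Ideal.Quotient.mk (Ideal.span {c}) (Quotient.out x) = x :=
  Quotient.out_eq x

lemma mk_eq_mk_iff (c a b : Zi) :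
    Ideal.Quotient.mk (Ideal.span {c}) a = Ideal.Quotient.mk (Ideal.span {c}) b ↔ c ∣ a - b := by
  rw [Ideal.Quotient.eq, Ideal.mem_span_singleton]

/-- `f` depends only on the residue modulo `c`. -/
def ResiduePeriodic (c : Zi) (f : Zi → ℂ) : Prop := ∀ a b, c ∣ a - b → f a = f b

lemma residueSum_congr (c : Zi) {f g : Zi → ℂ} (h : ∀ d, f d = g d) :
    residueSum c f = residueSum c g := by
  rw [funext h]

lemma residueSum_const_mul (c : Zi) (z : ℂ) (f : Zi → ℂ) :
    residueSum c (fun d => z * f d) = z * residueSum c f :=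
  (mul_finsum _ _).symm

lemma residueSum_sub {c : Zi} (hc : c ≠ 0) (f g : Zi → ℂ) :
    residueSum c (fun d => f d - g d) = residueSum c f - residueSum c g := by
  have := finite_residues hc
  exact finsum_sub_distrib (Set.toFinite _) (Set.toFinite _)

lemma residueSum_add_right {c : Zi} {f : Zi → ℂ} (hf : ResiduePeriodic c f) (w : Zi) :
    residueSum c (fun d => f (d + w)) = residueSum c f := by
  refine finsum_eq_of_bijective (fun x => x + Ideal.Quotient.mk (Ideal.span {c}) w)
    (Equiv.addRight _).bijective fun x => hf _ _ ?_
  rw [← mk_eq_mk_iff, mk_out, map_add, mk_out]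

lemma residueSum_mul_left {c : Zi} {f : Zi → ℂ} (hf : ResiduePeriodic c f) {u : Zi}
    (hu : IsCoprime u c) : residueSum c (fun d => f (u * d)) = residueSum c f := by
  obtain ⟨a, b, hab⟩ := hu
  have h : Ideal.Quotient.mk (Ideal.span {c}) a * Ideal.Quotient.mk (Ideal.span {c}) u = 1 := by
    rw [← map_mul, ← map_one (Ideal.Quotient.mk (Ideal.span {c})), mk_eq_mk_iff]
    exact ⟨-b, by linear_combination hab⟩
  refine finsum_eq_of_bijective (fun x => Ideal.Quotient.mk (Ideal.span {c}) u * x)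
    (Units.mulLeft_bijective ⟨_, _, (mul_comm _ _).trans h, h⟩) fun x => hf _ _ ?_
  rw [← mk_eq_mk_iff, mk_out, map_mul, mk_out]

lemma residueSum_mul {a b : Zi} (ha : a ≠ 0) (hb : b ≠ 0) {f : Zi → ℂ}
    (hf : ResiduePeriodic (a * b) f) :
    residueSum (a * b) f = residueSum a fun x => residueSum b fun y => f (x + a * y) := by
  have := finite_residues ha
  have := finite_residues hb
  have hbij : Function.Bijective fun p : (Zi ⧸ Ideal.span {a}) × (Zi ⧸ Ideal.span {b}) =>
      Ideal.Quotient.mk (Ideal.span {a * b}) (Quotient.out p.1 + a * Quotient.out p.2) := by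
    constructor
    · rintro ⟨x, y⟩ ⟨x', y'⟩ h
      obtain ⟨k, hk⟩ := (mk_eq_mk_iff _ _ _).1 h
      dsimp only at hk
      have hx : x = x' := by
        rw [← mk_out a x, ← mk_out a x', mk_eq_mk_iff]
        exact ⟨b * k - Quotient.out y + Quotient.out y', by linear_combination hk⟩
      subst hx
      have hy : y = y' := by
        rw [← mk_out b y, ← mk_out b y', mk_eq_mk_iff]
        exact ⟨k, mul_left_cancel₀ ha (by linear_combination hk)⟩
      rw [hy]
    · intro z
      obtain ⟨d, rfl⟩ := Ideal.Quotient.mk_surjective z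
      obtain ⟨k, hk⟩ := dvd_out_sub a d
      obtain ⟨l, hl⟩ := dvd_out_sub b (-k)
      refine ⟨(Ideal.Quotient.mk _ d, Ideal.Quotient.mk _ (-k)), ?_⟩
      rw [mk_eq_mk_iff]
      exact ⟨l, by linear_combination hk + a * hl⟩
  have h := finsum_eq_of_bijective (f := fun p : (Zi ⧸ Ideal.span {a}) × (Zi ⧸ Ideal.span {b}) =>
    f (Quotient.out p.1 + a * Quotient.out p.2)) (g := fun z => f (Quotient.out z)) _ hbij
    fun p => hf _ _ (by rw [← dvd_neg, neg_sub]; exact dvd_out_sub _ _)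
  exact h.symm.trans (finsum_curry _ (Set.toFinite _))

lemma residueSum_mul_of_periodic {a b : Zi} (ha : a ≠ 0) (hb : b ≠ 0) {f : Zi → ℂ}
    (hf : ResiduePeriodic a f) : residueSum (a * b) f = Ni b * residueSum a f := by
  have := finite_residues hb
  rw [residueSum_mul ha hb fun x y h => hf x y (dvd_of_mul_right_dvd h),
    ← residueSum_const_mul a]
  refine residueSum_congr a fun x => ?_
  have h : ∀ y, f (x + a * y) = f x := fun y => hf _ _ ⟨y, by ring⟩
  have := Fintype.ofFinite (Zi ⧸ Ideal.span {b})
  simp only [h, residueSum]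
  rw [finsum_eq_sum_of_fintype, Finset.sum_const, nsmul_eq_mul, ← card_residues b]
  simp

lemma residueSum_restrict_dvd {a p : Zi} (ha : a ≠ 0) (hp : p ≠ 0) {f : Zi → ℂ}
    (hf : ResiduePeriodic (p * a) f) :
    residueSum (p * a) (fun d => if p ∣ d then f d else 0) = residueSum a fun d => f (p * d) := by
  have := finite_residues hp
  have hper : ResiduePeriodic (p * a) fun d => if p ∣ d then f d else 0 := fun x y h => by
    have : p ∣ x ↔ p ∣ y := (dvd_iff_dvd_of_dvd_sub (dvd_of_mul_right_dvd h))
    simp only [this, hf x y h]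
  have hper' : ResiduePeriodic a fun d => f (p * d) := fun x y h =>
    hf _ _ (by rw [← mul_sub]; exact mul_dvd_mul_left p h)
  rw [residueSum_mul hp ha hper]
  have hdvd : ∀ x y : Zi, p ∣ x + p * y ↔ p ∣ x := fun x y => by
    rw [dvd_add_left (dvd_mul_right p y)]
  simp only [hdvd]
  rw [residueSum, finsum_eq_single _ (0 : Zi ⧸ Ideal.span {p})]
  · obtain ⟨k, hk⟩ : p ∣ Quotient.out (0 : Zi ⧸ Ideal.span {p}) := by
      simpa using dvd_out_sub p 0
    rw [← residueSum_add_right hper' k]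
    refine residueSum_congr a fun d => ?_
    rw [hk, if_pos (dvd_mul_right p k)]
    ring_nf
  · intro x hx
    have : ¬ p ∣ Quotient.out x := fun h => hx (by
      rw [← mk_out p x, Ideal.Quotient.eq_zero_iff_mem, Ideal.mem_span_singleton]
      exact h)
    simp [residueSum, this]

/-! ### The quartic residue symbol -/

lemma eq_of_pow_four_eq_one {u : Zi} (hu : u ^ 4 = 1) :
    u = 1 ∨ u = -1 ∨ u = ⟨0, 1⟩ ∨ u = ⟨0, -1⟩ := by
  have hi : (⟨0, 1⟩ : Zi) ^ 2 = -1 := by decide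
  have hn : (⟨0, -1⟩ : Zi) = -⟨0, 1⟩ := by decide
  have h : (u - 1) * ((u + 1) * ((u - ⟨0, 1⟩) * (u - ⟨0, -1⟩))) = 0 := by
    rw [hn]
    linear_combination hu - (u ^ 2 - 1) * hi
  simpa only [mul_eq_zero, sub_eq_zero, add_eq_zero_iff_eq_neg] using h

lemma eq_of_pow_four_of_dvd_sub {p u w : Zi} (hp : Prime p) (ho : Odd (Ni p)) (hu : u ^ 4 = 1)
    (hw : w ^ 4 = 1) (h : p ∣ u - w) : u = w := by
  by_contra hne
  have h4 : Ni p ∣ 4 := (Ni_dvd h).trans (by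
    rcases eq_of_pow_four_eq_one hu with rfl | rfl | rfl | rfl <;>
    rcases eq_of_pow_four_eq_one hw with rfl | rfl | rfl | rfl <;>
    first
    | exact absurd rfl hne
    | decide)
  have h1 : IsCoprime (Ni p) 4 := by
    obtain ⟨k, hk⟩ := ho
    have : IsCoprime (Ni p) 2 := ⟨1, -k, by linear_combination hk⟩
    simpa using this.pow_right (n := 2)
  have h2 : IsUnit (Ni p) := h1.isUnit_of_dvd' dvd_rfl h4
  exact hp.not_isUnit (Zsqrtd.norm_eq_one_iff.1 (Int.isUnit_iff_natAbs_eq.1 h2))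

lemma exists_Ni_eq_four_mul_add_one {c : Zi} (ho : Odd (Ni c)) : ∃ n : ℕ, Ni c = 4 * n + 1 := by
  have h0 : 0 ≤ Ni c := GaussianInt.norm_nonneg c
  have h : Ni c = c.re ^ 2 + c.im ^ 2 := by simp [Ni, Zsqrtd.norm]; ring
  obtain ⟨k, hk⟩ : ∃ k, Ni c = 4 * k + 1 := by
    rcases Int.even_or_odd' c.re with ⟨a, ha | ha⟩ <;>
    rcases Int.even_or_odd' c.im with ⟨b, hb | hb⟩
    · exact absurd ho (Int.not_odd_iff_even.2 ⟨2 * a ^ 2 + 2 * b ^ 2, by rw [h, ha, hb]; ring⟩)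
    · exact ⟨a ^ 2 + b ^ 2 + b, by rw [h, ha, hb]; ring⟩
    · exact ⟨a ^ 2 + a + b ^ 2, by rw [h, ha, hb]; ring⟩
    · exact absurd ho (Int.not_odd_iff_even.2
        ⟨2 * a ^ 2 + 2 * a + 2 * b ^ 2 + 2 * b + 1, by rw [h, ha, hb]; ring⟩)
  lift k to ℕ using by omega
  exact ⟨k, hk⟩

lemma isMaximal_span_of_prime {p : Zi} (hp : Prime p) : (Ideal.span {p}).IsMaximal :=
  PrincipalIdealRing.isMaximal_of_irreducible hp.irreducible

lemma dvd_pow_sub_one_of_prime {α p : Zi} (hp : Prime p) (hα : ¬ p ∣ α) :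
    p ∣ α ^ (Ni p - 1).toNat - 1 := by
  have := isMaximal_span_of_prime hp
  let := Ideal.Quotient.field (Ideal.span {p})
  have := finite_residues hp.ne_zero
  have := Fintype.ofFinite (Zi ⧸ Ideal.span {p})
  have hc : (Ni p - 1).toNat = Fintype.card (Zi ⧸ Ideal.span {p}) - 1 := by
    rw [← card_residues p, Nat.card_eq_fintype_card]
    omega
  rw [← mk_eq_mk_iff, map_pow, map_one, hc]
  refine FiniteField.pow_card_sub_one_eq_one _ fun h => hα ?_
  rwa [Ideal.Quotient.eq_zero_iff_mem, Ideal.mem_span_singleton] at h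

lemma exists_not_dvd_pow_half_sub_one {p : Zi} (hp : Prime p) (ho : Odd (Ni p)) :
    ∃ t, ¬ p ∣ t ∧ ¬ p ∣ t ^ ((Ni p / 2).toNat) - 1 := by
  have := isMaximal_span_of_prime hp
  let := Ideal.Quotient.field (Ideal.span {p})
  have := finite_residues hp.ne_zero
  have := Fintype.ofFinite (Zi ⧸ Ideal.span {p})
  have hcard : (Fintype.card (Zi ⧸ Ideal.span {p}) : ℤ) = Ni p := by
    rw [← card_residues p, Nat.card_eq_fintype_card]
  have hchar : ringChar (Zi ⧸ Ideal.span {p}) ≠ 2 := fun h => by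
    have h2 := FiniteField.even_card_iff_char_two.1 h
    rw [← hcard, Int.odd_iff] at ho
    omega
  obtain ⟨a, ha⟩ := FiniteField.exists_nonsquare hchar
  obtain ⟨t, rfl⟩ := Ideal.Quotient.mk_surjective a
  have ht : Ideal.Quotient.mk (Ideal.span {p}) t ≠ 0 := fun h => ha (h ▸ IsSquare.zero)
  refine ⟨t, fun h => ht ?_, fun h => ha ?_⟩
  · rwa [Ideal.Quotient.eq_zero_iff_mem, Ideal.mem_span_singleton]
  · rw [FiniteField.isSquare_iff hchar ht]
    rw [← mk_eq_mk_iff, map_pow, map_one] at h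
    convert h using 2
    omega

lemma exists_quartic_root {α p : Zi} (hp : Prime p) (ho : Odd (Ni p)) (hα : ¬ p ∣ α) :
    ∃ u : Zi, u ^ 4 = 1 ∧ p ∣ α ^ ((Ni p - 1) / 4).toNat - u := by
  obtain ⟨n, hn⟩ := exists_Ni_eq_four_mul_add_one ho
  have h := dvd_pow_sub_one_of_prime hp hα
  have e1 : (Ni p - 1).toNat = n * 4 := by omega
  have e2 : ((Ni p - 1) / 4).toNat = n := by omega
  rw [e1, pow_mul] at h
  rw [e2]
  have hi : (⟨0, 1⟩ : Zi) ^ 2 = -1 := by decide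
  have hf : (α ^ n) ^ 4 - 1 =
      (α ^ n - 1) * ((α ^ n - -1) * ((α ^ n - ⟨0, 1⟩) * (α ^ n - -⟨0, 1⟩))) := by
    linear_combination ((α ^ n) ^ 2 - 1) * hi
  rw [hf] at h
  rcases hp.dvd_or_dvd h with h | h
  · exact ⟨1, one_pow 4, h⟩
  rcases hp.dvd_or_dvd h with h | h
  · exact ⟨-1, by decide, h⟩
  rcases hp.dvd_or_dvd h with h | h
  · exact ⟨⟨0, 1⟩, by decide, h⟩
  · exact ⟨-⟨0, 1⟩, by decide, h⟩

lemma quarticPrime_spec_s7 {α p : Zi} (hp : Prime p) (ho : Odd (Ni p)) (hα : ¬ p ∣ α) :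
    quarticPrime α p ^ 4 = 1 ∧ p ∣ α ^ ((Ni p - 1) / 4).toNat - quarticPrime α p := by
  have h := exists_quartic_root hp ho hα
  rw [quarticPrime, dif_pos h]
  exact h.choose_spec

lemma quarticPrime_eq {α p u : Zi} (hp : Prime p) (ho : Odd (Ni p)) (hα : ¬ p ∣ α)
    (hu : u ^ 4 = 1) (h : p ∣ α ^ ((Ni p - 1) / 4).toNat - u) : quarticPrime α p = u := by
  obtain ⟨h1, h2⟩ := quarticPrime_spec_s7 hp ho hα
  exact eq_of_pow_four_of_dvd_sub hp ho h1 hu (by simpa using dvd_sub h h2)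

lemma quarticPrime_mul {α β p : Zi} (hp : Prime p) (ho : Odd (Ni p)) (hα : ¬ p ∣ α)
    (hβ : ¬ p ∣ β) : quarticPrime (α * β) p = quarticPrime α p * quarticPrime β p := by
  obtain ⟨h1, k, hk⟩ := quarticPrime_spec_s7 hp ho hα
  obtain ⟨h2, l, hl⟩ := quarticPrime_spec_s7 hp ho hβ
  refine quarticPrime_eq hp ho (fun h => (hp.dvd_or_dvd h).elim hα hβ)
    (by rw [mul_pow, h1, h2, one_mul])
    ⟨k * β ^ ((Ni p - 1) / 4).toNat + l * quarticPrime α p, ?_⟩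
  rw [mul_pow]
  linear_combination β ^ ((Ni p - 1) / 4).toNat * hk + quarticPrime α p * hl

lemma quarticPrime_congr {α β p : Zi} (hp : Prime p) (ho : Odd (Ni p)) (hβ : ¬ p ∣ β)
    (h : p ∣ α - β) : quarticPrime α p = quarticPrime β p := by
  obtain ⟨h1, h2⟩ := quarticPrime_spec_s7 hp ho hβ
  refine quarticPrime_eq hp ho (fun h' => hβ ((dvd_iff_dvd_of_dvd_sub h).1 h')) h1 ?_
  have := dvd_add (h.trans (sub_dvd_pow_sub_pow α β ((Ni p - 1) / 4).toNat)) h2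
  simpa using this

lemma quarticPrime_associated {α p q : Zi} (hp : Prime p) (ho : Odd (Ni p)) (hα : ¬ p ∣ α)
    (h : Associated p q) : quarticPrime α q = quarticPrime α p := by
  have hN : Ni q = Ni p := Int.dvd_antisymm (GaussianInt.norm_nonneg q)
    (GaussianInt.norm_nonneg p) (Ni_dvd h.dvd') (Ni_dvd h.dvd)
  obtain ⟨h1, h2⟩ := quarticPrime_spec_s7 hp ho hα
  refine quarticPrime_eq (h.prime hp) (hN ▸ ho) (fun h' => hα (h.dvd.trans h')) h1 ?_
  rw [hN]
  exact h.dvd'.trans h2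

lemma quarticSym_of_not_isCoprime {α c : Zi} (h : ¬ IsCoprime α c) : quarticSym α c = 0 :=
  if_neg h

lemma quarticSym_of_isCoprime {α c : Zi} (h : IsCoprime α c) :
    quarticSym α c = ((UniqueFactorizationMonoid.factors c).map
      fun p => GaussianInt.toComplex (quarticPrime α p)).prod :=
  if_pos h

lemma not_dvd_of_isCoprime {α c p : Zi} (h : IsCoprime α c) (hp : Prime p) (hc : p ∣ c) :
    ¬ p ∣ α :=
  fun hα => hp.not_isUnit (h.isUnit_of_dvd' hα hc)

lemma prime_odd_dvd_of_mem_factors {c p : Zi} (hc : Odd (Ni c))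
    (hp : p ∈ UniqueFactorizationMonoid.factors c) : Prime p ∧ Odd (Ni p) ∧ p ∣ c :=
  have hd := UniqueFactorizationMonoid.dvd_of_mem_factors hp
  ⟨UniqueFactorizationMonoid.prime_of_factor p hp, odd_Ni_of_dvd hd hc, hd⟩

lemma prod_quarticPrime_eq_of_rel {α : Zi} {s t : Multiset Zi}
    (hs : ∀ p ∈ s, Prime p ∧ Odd (Ni p) ∧ ¬ p ∣ α) (h : Multiset.Rel Associated s t) :
    (s.map fun p => GaussianInt.toComplex (quarticPrime α p)).prod =
      (t.map fun p => GaussianInt.toComplex (quarticPrime α p)).prod := by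
  congr 1
  rw [← Multiset.rel_eq, Multiset.rel_map]
  refine h.mono fun p hp q _ hpq => ?_
  obtain ⟨h1, h2, h3⟩ := hs p hp
  rw [quarticPrime_associated h1 h2 h3 hpq]

lemma quarticSym_mul_right {α a b : Zi} (ho : Odd (Ni (a * b))) :
    quarticSym α (a * b) = quarticSym α a * quarticSym α b := by
  by_cases h : IsCoprime α (a * b)
  · obtain ⟨h1, h2⟩ := IsCoprime.mul_right_iff.1 h
    have h0 := ne_zero_of_odd_Ni ho
    rw [quarticSym_of_isCoprime h, quarticSym_of_isCoprime h1, quarticSym_of_isCoprime h2,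
      ← Multiset.prod_add, ← Multiset.map_add]
    refine prod_quarticPrime_eq_of_rel (fun p hp => ?_)
      (UniqueFactorizationMonoid.factors_mul (left_ne_zero_of_mul h0) (right_ne_zero_of_mul h0))
    obtain ⟨hp1, hp2, hp3⟩ := prime_odd_dvd_of_mem_factors ho hp
    exact ⟨hp1, hp2, not_dvd_of_isCoprime h hp1 hp3⟩
  · rw [quarticSym_of_not_isCoprime h]
    rw [IsCoprime.mul_right_iff, not_and_or] at h
    rcases h with h | h <;> simp [quarticSym_of_not_isCoprime h]

lemma quarticSym_of_prime {α p : Zi} (hp : Prime p) (ho : Odd (Ni p)) (hα : ¬ p ∣ α) :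
    quarticSym α p = GaussianInt.toComplex (quarticPrime α p) := by
  obtain ⟨q, hq, hf⟩ := prime_factors_irreducible hp.irreducible
    ⟨UniqueFactorizationMonoid.prime_of_factor, UniqueFactorizationMonoid.factors_prod hp.ne_zero⟩
  rw [quarticSym_of_isCoprime ((hp.irreducible.coprime_iff_not_dvd.2 hα).symm), hf,
    Multiset.map_singleton, Multiset.prod_singleton, quarticPrime_associated hp ho hα hq]

lemma quarticSym_one_right (α : Zi) : quarticSym α 1 = 1 := by
  rw [quarticSym_of_isCoprime isCoprime_one_right, UniqueFactorizationMonoid.factors_one]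
  rfl

lemma odd_Ni_pow {a : Zi} (ho : Odd (Ni a)) (j : ℕ) : Odd (Ni (a ^ j)) := by
  induction j with
  | zero => rw [pow_zero]; decide
  | succ j ih =>
    rw [pow_succ, Ni_mul]
    exact ih.mul ho

lemma quarticSym_pow_right {α a : Zi} (ho : Odd (Ni a)) (j : ℕ) :
    quarticSym α (a ^ j) = quarticSym α a ^ j := by
  induction j with
  | zero => rw [pow_zero, pow_zero, quarticSym_one_right]
  | succ j ih =>
    rw [pow_succ, quarticSym_mul_right (pow_succ a j ▸ odd_Ni_pow ho (j + 1)), ih, pow_succ]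

lemma quarticSym_mul_left {α β c : Zi} (ho : Odd (Ni c)) :
    quarticSym (α * β) c = quarticSym α c * quarticSym β c := by
  by_cases h : IsCoprime (α * β) c
  · obtain ⟨h1, h2⟩ := IsCoprime.mul_left_iff.1 h
    rw [quarticSym_of_isCoprime h, quarticSym_of_isCoprime h1, quarticSym_of_isCoprime h2,
      ← Multiset.prod_map_mul]
    congr 1
    refine Multiset.map_congr rfl fun p hp => ?_
    obtain ⟨hp1, hp2, hp3⟩ := prime_odd_dvd_of_mem_factors ho hp
    rw [quarticPrime_mul hp1 hp2 (not_dvd_of_isCoprime h1 hp1 hp3)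
      (not_dvd_of_isCoprime h2 hp1 hp3), map_mul]
  · rw [quarticSym_of_not_isCoprime h]
    rw [IsCoprime.mul_left_iff, not_and_or] at h
    rcases h with h | h <;> simp [quarticSym_of_not_isCoprime h]

lemma quarticSym_pow_four {α c : Zi} (ho : Odd (Ni c)) (h : IsCoprime α c) :
    quarticSym α c ^ 4 = 1 := by
  rw [quarticSym_of_isCoprime h, ← Multiset.prod_map_pow]
  refine Multiset.prod_eq_one fun z hz => ?_
  obtain ⟨p, hp, rfl⟩ := Multiset.mem_map.1 hz
  obtain ⟨hp1, hp2, hp3⟩ := prime_odd_dvd_of_mem_factors ho hp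
  rw [← map_pow, (quarticPrime_spec_s7 hp1 hp2 (not_dvd_of_isCoprime h hp1 hp3)).1, map_one]

lemma isCoprime_of_forall_prime_dvd_sub {α β c : Zi} (hc : c ≠ 0)
    (h : ∀ p, Prime p → p ∣ c → p ∣ α - β) (hβ : IsCoprime β c) : IsCoprime α c :=
  isCoprime_of_prime_dvd (fun h0 => hc h0.2) fun p hp hpα hpc =>
    not_dvd_of_isCoprime hβ hp hpc ((dvd_iff_dvd_of_dvd_sub (h p hp hpc)).1 hpα)

/-- The symbol `(α/c)₄` depends on `α` only modulo the radical of `c`. -/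
lemma quarticSym_congr {α β c : Zi} (ho : Odd (Ni c))
    (h : ∀ p, Prime p → p ∣ c → p ∣ α - β) : quarticSym α c = quarticSym β c := by
  have hc := ne_zero_of_odd_Ni ho
  by_cases hβ : IsCoprime β c
  · have hα := isCoprime_of_forall_prime_dvd_sub hc h hβ
    rw [quarticSym_of_isCoprime hα, quarticSym_of_isCoprime hβ]
    congr 1
    refine Multiset.map_congr rfl fun p hp => ?_
    obtain ⟨hp1, hp2, hp3⟩ := prime_odd_dvd_of_mem_factors ho hp
    rw [quarticPrime_congr hp1 hp2 (not_dvd_of_isCoprime hβ hp1 hp3) (h p hp1 hp3)]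
  · have hα : ¬ IsCoprime α c := fun hα => hβ (isCoprime_of_forall_prime_dvd_sub hc
      (fun p hp hpc => by rw [← dvd_neg, neg_sub]; exact h p hp hpc) hα)
    rw [quarticSym_of_not_isCoprime hα, quarticSym_of_not_isCoprime hβ]

lemma quarticSym_eq_of_dvd_sub {α β c : Zi} (ho : Odd (Ni c)) (h : c ∣ α - β) :
    quarticSym α c = quarticSym β c :=
  quarticSym_congr ho fun _ _ hpc => hpc.trans h

lemma exists_quarticPrime_sq_ne_one {p : Zi} (hp : Prime p) (ho : Odd (Ni p)) :
    ∃ t, ¬ p ∣ t ∧ quarticPrime t p ^ 2 ≠ 1 := by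
  obtain ⟨t, ht, ht2⟩ := exists_not_dvd_pow_half_sub_one hp ho
  refine ⟨t, ht, fun h => ht2 ?_⟩
  obtain ⟨n, hn⟩ := exists_Ni_eq_four_mul_add_one ho
  have e1 : (Ni p / 2).toNat = n * 2 := by omega
  have e2 : ((Ni p - 1) / 4).toNat = n := by omega
  have h2 := (quarticPrime_spec_s7 hp ho ht).2
  rw [e2] at h2
  rw [e1, pow_mul, ← h]
  exact h2.trans (sub_dvd_pow_sub_pow _ _ 2)

/-! ### Quartic Gauss sums -/

/-- The additive character `a ↦ ě(a / (λ²c))` of `ℤ[i]`. -/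
def addCharMod (a c : Zi) : ℂ :=
  eCheck (GaussianInt.toComplex a / GaussianInt.toComplex lam ^ 2 / GaussianInt.toComplex c)

lemma addCharMod_eq (a c : Zi) : addCharMod a c =
    Complex.exp (2 * Real.pi * Complex.I *
      ((GaussianInt.toComplex a / GaussianInt.toComplex c).im : ℂ)) := by
  have hl : GaussianInt.toComplex lam ^ 2 = 2 * Complex.I := by
    have : GaussianInt.toComplex lam = 1 + Complex.I := by simp [lam, GaussianInt.toComplex_def']
    rw [this]
    linear_combination Complex.I_sq
  rw [addCharMod, eCheck, hl]
  congr 2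
  generalize GaussianInt.toComplex a = x
  generalize GaussianInt.toComplex c = y
  have h : x / (2 * Complex.I) / y = -Complex.I * (x / y) / 2 := by
    rw [div_right_comm, div_mul_eq_div_div, div_I]
    ring
  rw [h, Complex.add_conj]
  congr 1
  simp
  ring

lemma addCharMod_add (a b c : Zi) :
    addCharMod (a + b) c = addCharMod a c * addCharMod b c := by
  rw [addCharMod_eq, addCharMod_eq, addCharMod_eq, ← Complex.exp_add, map_add, add_div,
    Complex.add_im]
  push_cast
  ring_nf

lemma addCharMod_mul_right {k : Zi} (hk : k ≠ 0) (a c : Zi) :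
    addCharMod (a * k) (c * k) = addCharMod a c := by
  have : GaussianInt.toComplex k ≠ 0 := GaussianInt.toComplex_eq_zero.not.2 hk
  rw [addCharMod_eq, addCharMod_eq, map_mul, map_mul, mul_div_mul_right _ _ this]

lemma addCharMod_of_dvd {a c : Zi} (hc : c ≠ 0) (h : c ∣ a) : addCharMod a c = 1 := by
  obtain ⟨k, rfl⟩ := h
  have : GaussianInt.toComplex c ≠ 0 := GaussianInt.toComplex_eq_zero.not.2 hc
  rw [addCharMod_eq, map_mul, mul_div_cancel_left₀ _ this, Complex.exp_eq_one_iff]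
  exact ⟨k.im, by rw [← GaussianInt.intCast_im]; push_cast; ring⟩

lemma addCharMod_congr {a b c : Zi} (hc : c ≠ 0) (h : c ∣ a - b) :
    addCharMod a c = addCharMod b c := by
  rw [← sub_add_cancel a b, addCharMod_add, addCharMod_of_dvd hc h, one_mul]

lemma exists_int_im_of_addCharMod_eq_one {a c : Zi} (h : addCharMod a c = 1) :
    ∃ n : ℤ, (GaussianInt.toComplex a / GaussianInt.toComplex c).im = n := by
  rw [addCharMod_eq, Complex.exp_eq_one_iff] at h
  obtain ⟨n, hn⟩ := h
  refine ⟨n, ?_⟩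
  have h2 : (2 * Real.pi * Complex.I : ℂ) ≠ 0 := Complex.two_pi_I_ne_zero
  rw [mul_comm (n : ℂ)] at hn
  exact_mod_cast mul_left_cancel₀ h2 hn

lemma exists_addCharMod_ne_one {m c : Zi} (hc : c ≠ 0) (h : ¬ c ∣ m) :
    ∃ t, addCharMod (m * t) c ≠ 1 := by
  by_contra! hall
  refine h ?_
  obtain ⟨y, hy⟩ := exists_int_im_of_addCharMod_eq_one (hall 1)
  obtain ⟨x, hx⟩ := exists_int_im_of_addCharMod_eq_one (hall ⟨0, 1⟩)
  have hc' : GaussianInt.toComplex c ≠ 0 := GaussianInt.toComplex_eq_zero.not.2 hc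
  have hi : GaussianInt.toComplex ⟨0, 1⟩ = Complex.I := by simp [GaussianInt.toComplex_def']
  rw [mul_one] at hy
  rw [map_mul, hi, mul_div_right_comm, Complex.mul_I_im] at hx
  refine ⟨⟨x, y⟩, GaussianInt.toComplex_injective ?_⟩
  rw [map_mul, mul_comm, ← div_eq_iff hc', GaussianInt.toComplex_def₂ ⟨x, y⟩]
  exact Complex.ext hx hy

lemma g4_eq_residueSum (n c : Zi) :
    g4 (GaussianInt.toComplex n / GaussianInt.toComplex lam ^ 2) c =
      residueSum c fun d => quarticSym d c * addCharMod (n * d) c := by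
  refine finsum_congr fun x => ?_
  dsimp only
  rw [addCharMod, map_mul, div_mul_eq_mul_div]

lemma addCharMod_periodic {c : Zi} (hc : c ≠ 0) (n : Zi) :
    ResiduePeriodic c fun d => addCharMod (n * d) c :=
  fun x y h => addCharMod_congr hc (by rw [← mul_sub]; exact h.mul_left n)

lemma gaussTerm_periodic {c : Zi} (ho : Odd (Ni c)) (n : Zi) :
    ResiduePeriodic c fun d => quarticSym d c * addCharMod (n * d) c :=
  fun x y h => congrArg₂ (· * ·) (quarticSym_eq_of_dvd_sub ho h)
    (addCharMod_periodic (ne_zero_of_odd_Ni ho) n x y h)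

lemma quarticSym_mul_gaussSum {c u : Zi} (ho : Odd (Ni c)) (hu : IsCoprime u c) (n : Zi) :
    quarticSym u c * residueSum c (fun d => quarticSym d c * addCharMod (n * u * d) c) =
      residueSum c fun d => quarticSym d c * addCharMod (n * d) c := by
  rw [← residueSum_mul_left (gaussTerm_periodic ho n) hu, ← residueSum_const_mul]
  refine residueSum_congr c fun d => ?_
  rw [quarticSym_mul_left ho]
  ring_nf

lemma quarticSym_one_left {c : Zi} (ho : Odd (Ni c)) : quarticSym 1 c = 1 := by
  have h4 := quarticSym_pow_four ho (isCoprime_one_left (x := c))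
  have h2 : quarticSym 1 c = quarticSym 1 c * quarticSym 1 c := by
    rw [← quarticSym_mul_left ho, one_mul]
  have h0 : quarticSym 1 c ≠ 0 := fun h => by simp [h] at h4
  exact (mul_left_cancel₀ h0 (by rw [mul_one]; exact h2)).symm

lemma eq_zero_of_mul_eq_self {z w : ℂ} (hz : z ≠ 1) (h : z * w = w) : w = 0 := by
  by_contra hw
  exact hz (mul_right_cancel₀ hw (by rw [h, one_mul]))

lemma gaussSum_eq_zero_of_lt_four {m p a : Zi} (hp : Prime p) (hpa : ¬ p ∣ a) {j : ℕ}
    (hj0 : j ≠ 0) (hj4 : j < 4) (ho : Odd (Ni (a * p ^ j))) :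
    residueSum (a * p ^ j)
      (fun d => quarticSym d (a * p ^ j) * addCharMod (m * p ^ 3 * d) (a * p ^ j)) = 0 := by
  have hop : Odd (Ni p) := odd_Ni_of_dvd ((dvd_pow_self p hj0).mul_left a) ho
  have hoa : Odd (Ni a) := odd_Ni_of_dvd (dvd_mul_right a _) ho
  obtain ⟨t, ht, ht2⟩ := exists_quarticPrime_sq_ne_one hp hop
  obtain ⟨x, y, hxy⟩ := (hp.irreducible.coprime_iff_not_dvd.2 hpa).symm
  obtain ⟨u, hua, hup⟩ : ∃ u, a ∣ u - 1 ∧ p ∣ u - t :=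
    ⟨t * x * a + y * p, ⟨(t - 1) * x, by linear_combination hxy⟩,
      ⟨(1 - t) * y, by linear_combination t * hxy⟩⟩
  have hpu : ¬ p ∣ u := fun h => ht ((dvd_iff_dvd_of_dvd_sub hup).1 h)
  have hu : IsCoprime u (a * p ^ j) := by
    refine IsCoprime.mul_right ?_ (hp.irreducible.coprime_iff_not_dvd.2 hpu).symm.pow_right
    obtain ⟨k, hk⟩ := hua
    exact ⟨1, -k, by linear_combination hk⟩
  have hsym : quarticSym u (a * p ^ j) = GaussianInt.toComplex (quarticPrime t p ^ j) := by
    rw [quarticSym_mul_right ho, quarticSym_pow_right hop, quarticSym_eq_of_dvd_sub hoa hua,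
      quarticSym_one_left hoa, one_mul, quarticSym_of_prime hp hop hpu,
      quarticPrime_congr hp hop ht hup, map_pow]
  have hne : quarticSym u (a * p ^ j) ≠ 1 := by
    rw [hsym, ← map_one GaussianInt.toComplex]
    intro h
    have h1 := GaussianInt.toComplex_injective h
    have h4 := (quarticPrime_spec_s7 hp hop ht).1
    refine ht2 ?_
    have hj : 0 < j := Nat.pos_of_ne_zero hj0
    interval_cases j
    · rw [pow_one] at h1
      rw [h1, one_pow]
    · exact h1
    · rw [pow_succ _ 3, h1, one_mul] at h4
      rw [h4, one_pow]
  refine eq_zero_of_mul_eq_self hne ?_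
  conv_rhs => rw [← quarticSym_mul_gaussSum ho hu]
  congr 1
  refine residueSum_congr _ fun d => ?_
  congr 1
  refine addCharMod_congr (ne_zero_of_odd_Ni ho) ?_
  obtain ⟨l, hl⟩ : a * p ^ j ∣ (u - 1) * p ^ 3 := mul_dvd_mul hua (pow_dvd_pow p (by omega))
  exact ⟨-l * m * d, by linear_combination -m * d * hl⟩

lemma gaussSum_eq_zero_of_pow_five_dvd {m p c : Zi} (hp : Prime p) (hm : ¬ p ∣ m)
    (ho : Odd (Ni c)) (hc : p ^ 5 ∣ c) :
    residueSum c (fun d => quarticSym d c * addCharMod (m * p ^ 3 * d) c) = 0 := by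
  obtain ⟨a, rfl⟩ := hc
  have hc0 := ne_zero_of_odd_Ni ho
  obtain ⟨t, ht⟩ := exists_addCharMod_ne_one hp.ne_zero hm
  refine eq_zero_of_mul_eq_self ht ?_
  conv_rhs => rw [← residueSum_add_right (gaussTerm_periodic ho _) (p * a * t)]
  rw [← residueSum_const_mul]
  refine residueSum_congr _ fun d => ?_
  have hsym : quarticSym (d + p * a * t) (p ^ 5 * a) = quarticSym d (p ^ 5 * a) := by
    refine quarticSym_congr ho fun q hq hqc => ?_
    rw [add_sub_cancel_left]
    refine Dvd.dvd.mul_right ?_ t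
    rcases hq.dvd_or_dvd hqc with h | h
    · exact (hq.dvd_of_dvd_pow h).mul_right a
    · exact h.mul_left p
  have hchar : addCharMod (m * p ^ 3 * (p * a * t)) (p ^ 5 * a) = addCharMod (m * t) p := by
    have hk : p ^ 4 * a ≠ 0 := mul_ne_zero (pow_ne_zero 4 hp.ne_zero) (right_ne_zero_of_mul hc0)
    rw [← addCharMod_mul_right hk (m * t)]
    congr 1 <;> ring
  rw [hsym, mul_add, addCharMod_add, hchar]
  ring

lemma quarticSym_mul_pow_four_right {p a : Zi} (hp : Prime p) (ho : Odd (Ni (a * p ^ 4)))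
    (d : Zi) : quarticSym d (a * p ^ 4) = if p ∣ d then 0 else quarticSym d a := by
  have hop : Odd (Ni p) := odd_Ni_of_dvd ((dvd_pow_self p four_ne_zero).mul_left a) ho
  rw [quarticSym_mul_right ho, quarticSym_pow_right hop]
  split_ifs with h
  · rw [quarticSym_of_not_isCoprime fun h' => not_dvd_of_isCoprime h' hp dvd_rfl h]
    simp
  · rw [quarticSym_pow_four hop (hp.irreducible.coprime_iff_not_dvd.2 h).symm, mul_one]

lemma gaussSum_mul_pow_four {m p a : Zi} (hp : Prime p) (hpa : ¬ p ∣ a) (hm : ¬ p ∣ m)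
    (ho : Odd (Ni (a * p ^ 4))) :
    residueSum (a * p ^ 4)
        (fun d => quarticSym d (a * p ^ 4) * addCharMod (m * p ^ 3 * d) (a * p ^ 4)) =
      -(Ni p : ℂ) ^ 3 * residueSum a fun d => quarticSym d a * addCharMod (m * p ^ 3 * d) a := by
  have hoa : Odd (Ni a) := odd_Ni_of_dvd (dvd_mul_right a _) ho
  have ha0 := ne_zero_of_odd_Ni hoa
  have hpa0 : p * a ≠ 0 := mul_ne_zero hp.ne_zero ha0
  have hp3 : p ^ 3 ≠ 0 := pow_ne_zero 3 hp.ne_zero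
  have hcop : IsCoprime p a := hp.irreducible.coprime_iff_not_dvd.2 hpa
  set h : Zi → ℂ := fun d => quarticSym d a * addCharMod (m * d) (p * a) with hh
  have hper : ResiduePeriodic (p * a) h := fun x y hxy =>
    congrArg₂ (· * ·) (quarticSym_eq_of_dvd_sub hoa (dvd_of_mul_left_dvd hxy))
      (addCharMod_periodic hpa0 m x y hxy)
  have hterm : ∀ d, quarticSym d (a * p ^ 4) * addCharMod (m * p ^ 3 * d) (a * p ^ 4) =
      h d - if p ∣ d then h d else 0 := fun d => by
    have hchar : addCharMod (m * p ^ 3 * d) (a * p ^ 4) = addCharMod (m * d) (p * a) := by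
      rw [← addCharMod_mul_right hp3 (m * d)]
      congr 1 <;> ring
    rw [quarticSym_mul_pow_four_right hp ho, hchar, hh]
    split_ifs <;> simp
  have hdiff : ResiduePeriodic (p * a) fun d => h d - if p ∣ d then h d else 0 :=
    fun x y hxy => by
      have : p ∣ x ↔ p ∣ y := dvd_iff_dvd_of_dvd_sub (dvd_of_mul_right_dvd hxy)
      simp only [this, hper x y hxy]
  have hfull : residueSum (p * a) h = 0 := by
    obtain ⟨t, ht⟩ := exists_addCharMod_ne_one hp.ne_zero hm
    refine eq_zero_of_mul_eq_self ht ?_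
    conv_rhs => rw [← residueSum_add_right hper (a * t)]
    rw [← residueSum_const_mul]
    refine residueSum_congr _ fun d => ?_
    simp only [hh]
    rw [quarticSym_eq_of_dvd_sub hoa (⟨t, by ring⟩ : a ∣ d + a * t - d), mul_add, addCharMod_add,
      ← addCharMod_mul_right ha0 (m * t), show m * (a * t) = m * t * a by ring]
    ring
  have hdvd : residueSum a (fun d => h (p * d)) =
      residueSum a fun d => quarticSym d a * addCharMod (m * p ^ 3 * d) a := by
    have h1 : residueSum a (fun d => h (p * d)) =
        quarticSym p a * residueSum a fun d => quarticSym d a * addCharMod (m * d) a := by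
      rw [← residueSum_const_mul]
      refine residueSum_congr _ fun d => ?_
      simp only [hh]
      rw [quarticSym_mul_left hoa, ← addCharMod_mul_right hp.ne_zero (m * d) a, mul_comm a p,
        show m * (p * d) = m * d * p by ring]
      ring
    rw [h1, ← quarticSym_mul_gaussSum hoa (hcop.pow_left (m := 3)), ← mul_assoc,
      ← quarticSym_mul_left hoa, show p * p ^ 3 = p * p * (p * p) by ring,
      quarticSym_mul_left hoa, quarticSym_mul_left hoa,
      show ∀ z : ℂ, z * z * (z * z) = z ^ 4 from fun z => by ring,
      quarticSym_pow_four hoa hcop, one_mul]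
  rw [residueSum_congr _ hterm, show a * p ^ 4 = p * a * p ^ 3 by ring,
    residueSum_mul_of_periodic hpa0 hp3 hdiff, residueSum_sub hpa0, hfull,
    residueSum_restrict_dvd ha0 hp.ne_zero hper, hdvd]
  have : Ni (p ^ 3) = Ni p ^ 3 := by simp only [pow_succ, pow_zero, one_mul, Ni_mul]
  rw [this]
  push_cast
  ring

/-! ### The Dirichlet series -/

/-- The summand of `psiA`. -/
def psiTerm (α : Zi) (r s : ℂ) (v c : Zi) : ℂ :=
  if (4 : Zi) ∣ c - v ∧ IsCoprime c α then g4 r c / (Ni c : ℂ) ^ s else 0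

lemma lam_pow_three_dvd_four : lam ^ 3 ∣ 4 := ⟨⟨-1, -1⟩, by decide⟩

lemma odd_Ni_of_lam_pow_three_dvd_sub_one {c : Zi} (h : lam ^ 3 ∣ c - 1) : Odd (Ni c) := by
  obtain ⟨⟨x, y⟩, hk⟩ := (dvd_pow_self lam three_ne_zero).trans h
  obtain rfl : c = 1 + lam * ⟨x, y⟩ := by linear_combination hk
  refine ⟨x - y + x ^ 2 + y ^ 2, ?_⟩
  simp [Ni, Zsqrtd.norm, lam]
  ring

lemma four_dvd_pow_four_sub_one {p : Zi} (h : lam ^ 3 ∣ p - 1) : 4 ∣ p ^ 4 - 1 := by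
  obtain ⟨k, hk⟩ := h
  obtain rfl : p = 1 + lam ^ 3 * k := by linear_combination hk
  have hl : lam ^ 4 = -4 := by decide
  refine ⟨lam ^ 3 * k - 6 * lam ^ 2 * k ^ 2 - 4 * lam ^ 5 * k ^ 3 - lam ^ 8 * k ^ 4, ?_⟩
  linear_combination (6 * lam ^ 2 * k ^ 2 + 4 * lam ^ 5 * k ^ 3 + lam ^ 8 * k ^ 4) * hl

lemma Ni_mul_cpow (a b : Zi) (s : ℂ) :
    (Ni (a * b) : ℂ) ^ s = (Ni a : ℂ) ^ s * (Ni b : ℂ) ^ s := by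
  have h := Complex.mul_cpow_ofReal_nonneg (a := (Ni a : ℝ)) (b := (Ni b : ℝ))
    (by exact_mod_cast GaussianInt.norm_nonneg a) (by exact_mod_cast GaussianInt.norm_nonneg b) s
  rw [Ni_mul]
  exact_mod_cast h

lemma psiTerm_mul_prime {γ p : Zi} (hp : Prime p) (r s : ℂ) (v c : Zi) :
    psiTerm (γ * p) r s v c = if p ∣ c then 0 else psiTerm γ r s v c := by
  have h : IsCoprime c p ↔ ¬ p ∣ c := isCoprime_comm.trans hp.irreducible.coprime_iff_not_dvd
  rw [psiTerm, psiTerm, IsCoprime.mul_right_iff, h]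
  split_ifs <;> tauto

lemma psiTerm_mul_pow_four {γ p m v : Zi} (hpc : lam ^ 3 ∣ p - 1) (hp : Prime p)
    (hpγ : ¬ p ∣ γ) (hm : ¬ p ∣ m) (hv : lam ^ 3 ∣ v - 1) (s : ℂ) (c : Zi) :
    psiTerm γ (GaussianInt.toComplex (m * p ^ 3) / GaussianInt.toComplex lam ^ 2) s v
        (c * p ^ 4) =
      -(Ni p : ℂ) ^ ((3 : ℂ) - 4 * s) * psiTerm (γ * p)
        (GaussianInt.toComplex (m * p ^ 3) / GaussianInt.toComplex lam ^ 2) s v c := by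
  have hmod : (4 : Zi) ∣ c * p ^ 4 - v ↔ 4 ∣ c - v :=
    dvd_iff_dvd_of_dvd_sub (by
      rw [show c * p ^ 4 - v - (c - v) = c * (p ^ 4 - 1) by ring]
      exact (four_dvd_pow_four_sub_one hpc).mul_left c)
  have hcop : IsCoprime (c * p ^ 4) γ ↔ IsCoprime c γ := by
    rw [IsCoprime.mul_left_iff, and_iff_left]
    exact (hp.irreducible.coprime_iff_not_dvd.2 hpγ).pow_left
  rw [psiTerm_mul_prime hp, psiTerm, psiTerm, hmod, hcop]
  by_cases h : (4 : Zi) ∣ c - v ∧ IsCoprime c γ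
  swap
  · simp [h]
  rw [if_pos h, if_pos h, g4_eq_residueSum, g4_eq_residueSum]
  have ho : Odd (Ni (c * p ^ 4)) := odd_Ni_of_lam_pow_three_dvd_sub_one (by
    have := dvd_add (lam_pow_three_dvd_four.trans (hmod.2 h.1)) hv
    simpa using this)
  split_ifs with hpd
  · rw [gaussSum_eq_zero_of_pow_five_dvd hp hm ho, zero_div, mul_zero]
    rw [show p ^ 5 = p * p ^ 4 by ring]
    exact mul_dvd_mul_right hpd _
  have hN : (Ni p : ℂ) ≠ 0 := by exact_mod_cast (Ni_pos hp.ne_zero).ne'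
  have hpow : (Ni (p ^ 4) : ℂ) ^ s = ((Ni p : ℂ) ^ s) ^ 4 := by
    rw [show p ^ 4 = p * p * (p * p) by ring, Ni_mul_cpow, Ni_mul_cpow]
    ring
  rw [gaussSum_mul_pow_four hp hpd hm ho, Ni_mul_cpow, hpow, Complex.cpow_sub _ _ hN,
    Complex.cpow_ofNat, Complex.cpow_ofNat_mul, mul_comm ((Ni c : ℂ) ^ s), ← div_mul_div_comm,
    neg_div]

lemma psiTerm_eq_zero_of_dvd {γ p m v c : Zi} (hp : Prime p) (hv : lam ^ 3 ∣ v - 1) (s : ℂ)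
    (hpc : p ∣ c) (hc : ¬ p ^ 4 ∣ c) :
    psiTerm γ (GaussianInt.toComplex (m * p ^ 3) / GaussianInt.toComplex lam ^ 2) s v c = 0 := by
  rw [psiTerm]
  split_ifs with h
  swap
  · rfl
  have ho : Odd (Ni c) := odd_Ni_of_lam_pow_three_dvd_sub_one (by
    have := dvd_add (lam_pow_three_dvd_four.trans h.1) hv
    simpa using this)
  obtain ⟨j, a, ha, rfl⟩ := WfDvdMonoid.max_power_factor (ne_zero_of_odd_Ni ho) hp.irreducible
  have hj0 : j ≠ 0 := by
    rintro rfl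
    exact ha (by simpa using hpc)
  have hj4 : j < 4 := by
    by_contra! hj
    exact hc ((pow_dvd_pow p hj).mul_right a)
  rw [mul_comm] at ho
  rw [mul_comm (p ^ j)]
  rw [g4_eq_residueSum, gaussSum_eq_zero_of_lt_four hp ha hj0 hj4 ho, zero_div]

/-- Let `f = g + h`, where `g` is the restriction of `f` to the complement of `S` and `h`, its
restriction to `S`, is `k • g` transported along an injection. Then `∑' f = (1 + k) ∑' g`, even
where the series diverge. -/
lemma tsum_eq_one_add_mul_tsum_restrict {ι : Type*} {f : ι → ℂ} {S : Set ι} {e : ι → ι} {k : ℂ}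
    (he : Function.Injective e) (heS : ∀ x, e x ∈ S) (hf : ∀ x ∈ S, x ∉ Set.range e → f x = 0)
    (hk : ∀ x, f (e x) = k * Sᶜ.indicator f x) :
    ∑' x, f x = (1 + k) * ∑' x, Sᶜ.indicator f x := by
  by_cases hs : Summable (Sᶜ.indicator f)
  · have hcomp : S.indicator f ∘ e = fun x => k * Sᶜ.indicator f x := by
      funext x
      rw [Function.comp_apply, Set.indicator_of_mem (heS x), hk]
    have hzero : ∀ x ∉ Set.range e, S.indicator f x = 0 := fun x hx => by
      by_cases hxS : x ∈ S
      · rw [Set.indicator_of_mem hxS, hf x hxS hx]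
      · exact Set.indicator_of_notMem hxS f
    have hsum : HasSum (S.indicator f) (k * ∑' x, Sᶜ.indicator f x) := by
      rw [← he.hasSum_iff hzero, hcomp]
      exact hs.hasSum.mul_left k
    have h := (hs.hasSum.add hsum).tsum_eq
    rw [one_add_mul, ← h]
    refine tsum_congr fun x => ?_
    rw [add_comm]
    exact (congrFun (Set.indicator_self_add_compl S f) x).symm
  · have hs' : ¬ Summable f := fun h => hs (h.indicator Sᶜ)
    rw [tsum_eq_zero_of_not_summable hs, tsum_eq_zero_of_not_summable hs', mul_zero]

/-- Euler-type factor extraction for `ψ` at a cube `δπ³`. -/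
theorem psi_coprimality_cube (γ π : Zi) (hγ : lam ^ 3 ∣ γ - 1) (hπc : lam ^ 3 ∣ π - 1)
    (hπ : Prime π) (hnd : ¬ π ∣ γ)
    (δ : ℂ) (hδ : ∃ m : Zi, δ = GaussianInt.toComplex m / GaussianInt.toComplex lam ^ 2 ∧
      IsCoprime m π)
    (v : Zi) (hv : lam ^ 3 ∣ v - 1) (s : ℂ) (hs : 3 / 2 < s.re) :
    psiA γ (δ * GaussianInt.toComplex π ^ 3) s v =
      (1 - (Ni π : ℂ) ^ ((3 : ℂ) - 4 * s)) *
        psiA (γ * π) (δ * GaussianInt.toComplex π ^ 3) s v := by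
  obtain ⟨m, rfl, hm⟩ := hδ
  have hpm : ¬ π ∣ m := not_dvd_of_isCoprime hm hπ dvd_rfl
  have hr : GaussianInt.toComplex m / GaussianInt.toComplex lam ^ 2 * GaussianInt.toComplex π ^ 3 =
      GaussianInt.toComplex (m * π ^ 3) / GaussianInt.toComplex lam ^ 2 := by
    rw [map_mul, map_pow]
    ring
  rw [hr]
  set r := GaussianInt.toComplex (m * π ^ 3) / GaussianInt.toComplex lam ^ 2
  have hind : psiTerm (γ * π) r s v = {c : Zi | π ∣ c}ᶜ.indicator (psiTerm γ r s v) := by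
    funext c
    rw [psiTerm_mul_prime hπ]
    by_cases hc : π ∣ c <;> simp [hc]
  have h := tsum_eq_one_add_mul_tsum_restrict (f := psiTerm γ r s v) (S := {c : Zi | π ∣ c})
    (e := fun c => c * π ^ 4) (k := -(Ni π : ℂ) ^ ((3 : ℂ) - 4 * s))
    (mul_left_injective₀ (pow_ne_zero 4 hπ.ne_zero))
    (fun c => (dvd_pow_self π four_ne_zero).mul_left c)
    (fun c hc hcr => psiTerm_eq_zero_of_dvd hπ hv s hc
      fun ⟨a, ha⟩ => hcr ⟨a, by rw [ha, mul_comm]⟩)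
    (fun c => by rw [← hind]; exact psiTerm_mul_pow_four hπc hπ hnd hpm hv s c)
  rw [← hind, ← sub_eq_add_neg] at h
  exact h
end
end
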